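/- arXiv:1207.5363 — 2 statements merged into one kernel-verified Lean document; each statement's English description precedes it below -/
import Mathlib

section
/- Let H be a cocommutative weak Hopf algebra over a commutative ring k and (φ_A, σ) a crossed system for H over A. Consider the H-cleft extension A ↪ A×_σH with the convolution invertible total integral f = p_{A⊗H}∘(η_A⊗H), and let (ϕ_A, τ) be the crossed system for H over A induced by f on the coinvariant algebra A of A×_σH. Then (ϕ_A, τ) = (φ_A, σ). -/
open TensorProduct

noncomputable section

namespace WHA

variable (k : Type) [CommRing k]

/-- Generalized convolution product of two linear maps from a "coalgebra"
(given by a comultiplication `δC`) to a module `P` with a product `m`. -/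
def convG {C P : Type} [AddCommGroup C] [Module k C] [AddCommGroup P] [Module k P]
    (δC : C →ₗ[k] C ⊗[k] C) (m : P ⊗[k] P →ₗ[k] P) (f g : C →ₗ[k] P) : C →ₗ[k] P :=
  m ∘ₗ TensorProduct.map f g ∘ₗ δC

/-- Convolution product of two linear maps from a "coalgebra" to an algebra. -/
def conv {C A : Type} [AddCommGroup C] [Module k C] [Ring A] [Algebra k A]
    (δC : C →ₗ[k] C ⊗[k] C) (f g : C →ₗ[k] A) : C →ₗ[k] A :=
  convG k δC (LinearMap.mul' k A) f g

variable (H : Type) [Ring H] [Algebra k H]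

/-- The structure maps (comultiplication, counit, antipode) of a prospective
weak Hopf algebra on the `k`-algebra `H`. -/
structure HopfData where
  δ : H →ₗ[k] H ⊗[k] H
  ε : H →ₗ[k] k
  lam : H →ₗ[k] H

variable {k H}

/-- The target map `Π^L_H = ((ε∘μ)⊗H)∘(H⊗c)∘((δ∘η)⊗H)`. -/
def PiL (W : HopfData k H) : H →ₗ[k] H :=
  (TensorProduct.rid k H).toLinearMap
    ∘ₗ LinearMap.lTensor H (W.ε ∘ₗ LinearMap.mul' k H)
    ∘ₗ (TensorProduct.assoc k H H H).toLinearMap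
    ∘ₗ LinearMap.rTensor H (TensorProduct.comm k H H).toLinearMap
    ∘ₗ TensorProduct.mk k (H ⊗[k] H) H (W.δ 1)

/-- The source map `Π^R_H = (H⊗(ε∘μ))∘(c⊗H)∘(H⊗(δ∘η))`. -/
def PiR (W : HopfData k H) : H →ₗ[k] H :=
  (TensorProduct.lid k H).toLinearMap
    ∘ₗ LinearMap.rTensor H (W.ε ∘ₗ LinearMap.mul' k H)
    ∘ₗ (TensorProduct.assoc k H H H).symm.toLinearMap
    ∘ₗ LinearMap.lTensor H (TensorProduct.comm k H H).toLinearMap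
    ∘ₗ (TensorProduct.mk k H (H ⊗[k] H)).flip (W.δ 1)

/-- `H` together with the data `W` is a weak Hopf algebra. -/
structure IsWeakHopf (W : HopfData k H) : Prop where
  coassoc : ∀ h : H,
    (TensorProduct.assoc k H H H) ((LinearMap.rTensor H W.δ) (W.δ h)) =
      (LinearMap.lTensor H W.δ) (W.δ h)
  counit_left : ∀ h : H, (TensorProduct.lid k H) ((LinearMap.rTensor H W.ε) (W.δ h)) = h
  counit_right : ∀ h : H, (TensorProduct.rid k H) ((LinearMap.lTensor H W.ε) (W.δ h)) = h
  a1 : ∀ x y : H, W.δ (x * y) = W.δ x * W.δ y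
  a2 : ∀ x y z : H, W.ε (x * y * z) =
    LinearMap.mul' k k ((TensorProduct.map (W.ε ∘ₗ LinearMap.mulLeft k x)
      (W.ε ∘ₗ LinearMap.mulRight k z)) (W.δ y))
  a2' : ∀ x y z : H, W.ε (x * y * z) =
    LinearMap.mul' k k ((TensorProduct.map (W.ε ∘ₗ LinearMap.mulLeft k x)
      (W.ε ∘ₗ LinearMap.mulRight k z)) ((TensorProduct.comm k H H) (W.δ y)))
  a3 : (TensorProduct.assoc k H H H) ((LinearMap.rTensor H W.δ) (W.δ 1)) =
    (TensorProduct.map LinearMap.id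
        (Algebra.TensorProduct.includeLeft : H →ₐ[k] H ⊗[k] H).toLinearMap) (W.δ 1) *
      (Algebra.TensorProduct.includeRight : (H ⊗[k] H) →ₐ[k] H ⊗[k] (H ⊗[k] H)).toLinearMap
        (W.δ 1)
  a3' : (TensorProduct.assoc k H H H) ((LinearMap.rTensor H W.δ) (W.δ 1)) =
    (Algebra.TensorProduct.includeRight : (H ⊗[k] H) →ₐ[k] H ⊗[k] (H ⊗[k] H)).toLinearMap
        (W.δ 1) *
      (TensorProduct.map LinearMap.id
        (Algebra.TensorProduct.includeLeft : H →ₐ[k] H ⊗[k] H).toLinearMap) (W.δ 1)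
  a4_left : ∀ h : H,
    LinearMap.mul' k H ((TensorProduct.map LinearMap.id W.lam) (W.δ h)) = PiL W h
  a4_right : ∀ h : H,
    LinearMap.mul' k H ((TensorProduct.map W.lam LinearMap.id) (W.δ h)) = PiR W h
  a4_mid : conv k W.δ (conv k W.δ W.lam LinearMap.id) W.lam = W.lam

/-- `H` is cocommutative. -/
def Cocomm (W : HopfData k H) : Prop :=
  ∀ h : H, (TensorProduct.comm k H H) (W.δ h) = W.δ h

section ComodAlg

variable {A : Type} [Ring A] [Algebra k A]

/-- The map `ζ_A = (μ_A⊗H)∘(A⊗c_{H,A})∘((ρ_A∘η_A)⊗A)`; in the tensor product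
algebra `A ⊗ H` it is given by `a ↦ ρ(1) * (a ⊗ 1)`. -/
def zeta (ρ : A →ₗ[k] A ⊗[k] H) (a : A) : A ⊗[k] H :=
  ρ 1 * (a ⊗ₜ[k] (1 : H))

/-- `a` is a coinvariant element, i.e. belongs to `A_H`. -/
def IsCoinv (ρ : A →ₗ[k] A ⊗[k] H) (a : A) : Prop :=
  ρ a = zeta ρ a

/-- `(A, ρ)` is a right `H`-comodule algebra. -/
structure IsComodAlg (W : HopfData k H) (ρ : A →ₗ[k] A ⊗[k] H) : Prop where
  coassoc : ∀ a : A, (TensorProduct.assoc k A H H) ((LinearMap.rTensor H ρ) (ρ a)) =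
    (LinearMap.lTensor A W.δ) (ρ a)
  counit : ∀ a : A, (TensorProduct.rid k A) ((LinearMap.lTensor A W.ε) (ρ a)) = a
  mul_compat : ∀ a b : A, ρ (a * b) = ρ a * ρ b
  unit_coinv : (LinearMap.lTensor A (PiL W)) (ρ 1) = ρ 1

end ComodAlg

/-- For `t = Σ x ⊗ y : B ⊗ H`, the map `h ↦ Σ ε(h*y) • x`.  For
`t = ρ(1)` this is the map `e_A = (A⊗ε)∘Γ∘(H⊗η)`. -/
def eGen (W : HopfData k H) {B : Type} [AddCommGroup B] [Module k B]
    (t : B ⊗[k] H) : H →ₗ[k] B :=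
  (TensorProduct.lid k B).toLinearMap
    ∘ₗ LinearMap.rTensor B (W.ε ∘ₗ LinearMap.mul' k H)
    ∘ₗ (TensorProduct.assoc k H H B).symm.toLinearMap
    ∘ₗ LinearMap.lTensor H (TensorProduct.comm k B H).toLinearMap
    ∘ₗ (TensorProduct.mk k H (B ⊗[k] H)).flip t

/-- For `t = Σ x ⊗ y : B ⊗ H`, the map `h ↦ Σ ε(y*h) • x`.  For
`t = ρ(1)` this is the map `(A⊗(ε∘μ))∘((ρ∘η)⊗H)`. -/
def dGen (W : HopfData k H) {B : Type} [AddCommGroup B] [Module k B]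
    (t : B ⊗[k] H) : H →ₗ[k] B :=
  (TensorProduct.rid k B).toLinearMap
    ∘ₗ LinearMap.lTensor B (W.ε ∘ₗ LinearMap.mul' k H)
    ∘ₗ (TensorProduct.assoc k B H H).toLinearMap
    ∘ₗ TensorProduct.mk k (B ⊗[k] H) H t

section ComodAlg2

variable {A : Type} [Ring A] [Algebra k A]

/-- The entwining map `Γ_A^H = (A⊗μ_H)∘(c_{H,A}⊗H)∘(H⊗ρ_A)`. -/
def Γmap (ρ : A →ₗ[k] A ⊗[k] H) : H ⊗[k] A →ₗ[k] A ⊗[k] H :=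
  LinearMap.lTensor A (LinearMap.mul' k H)
    ∘ₗ (TensorProduct.assoc k A H H).toLinearMap
    ∘ₗ LinearMap.rTensor H (TensorProduct.comm k H A).toLinearMap
    ∘ₗ (TensorProduct.assoc k H A H).symm.toLinearMap
    ∘ₗ LinearMap.lTensor H ρ

/-- `f : H → A` is an integral, i.e. a morphism of right `H`-comodules. -/
def IsIntegral (W : HopfData k H) (ρ : A →ₗ[k] A ⊗[k] H) (f : H →ₗ[k] A) : Prop :=
  ∀ h : H, ρ (f h) = (LinearMap.rTensor H f) (W.δ h)

/-- `finv` is the convolution inverse of the integral `f` (conditions (c1)-(c3)). -/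
def IsConvInv (W : HopfData k H) (ρ : A →ₗ[k] A ⊗[k] H) (f finv : H →ₗ[k] A) : Prop :=
  conv k W.δ finv f = eGen W (ρ 1) ∧
  conv k W.δ f finv = dGen W (ρ 1) ∧
  conv k W.δ (conv k W.δ finv f) finv = finv

/-- `f` is a cleaving morphism (with convolution inverse `finv`) for the extension
`A_H ↪ A`, i.e. a convolution invertible integral such that `f ∧ f⁻¹` takes
values in the coinvariants. -/
def IsCleaving (W : HopfData k H) (ρ : A →ₗ[k] A ⊗[k] H) (f finv : H →ₗ[k] A) : Prop :=
  IsIntegral W ρ f ∧ IsConvInv W ρ f finv ∧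
    ∀ h : H, IsCoinv ρ (conv k W.δ f finv h)

end ComodAlg2

section ModAlg

variable {B : Type} [Ring B] [Algebra k B]

/-- `u₁ = φ ∘ (H ⊗ η_B)`. -/
def u1 (φ : H ⊗[k] B →ₗ[k] B) : H →ₗ[k] B :=
  φ ∘ₗ (TensorProduct.mk k H B).flip 1

/-- `u₂ = u₁ ∘ μ_H`. -/
def u2 (φ : H ⊗[k] B →ₗ[k] B) : H ⊗[k] H →ₗ[k] B :=
  u1 φ ∘ₗ LinearMap.mul' k H

/-- `(B, φ)` is a weak left `H`-module algebra (conditions (d1)-(d4)). -/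
def IsWeakModAlg (W : HopfData k H) (φ : H ⊗[k] B →ₗ[k] B) : Prop :=
  (∀ b : B, φ ((1 : H) ⊗ₜ[k] b) = b) ∧
  (∀ (h : H) (b c : B), φ (h ⊗ₜ[k] (b * c)) =
    LinearMap.mul' k B ((TensorProduct.map (φ ∘ₗ (TensorProduct.mk k H B).flip b)
      (φ ∘ₗ (TensorProduct.mk k H B).flip c)) (W.δ h))) ∧
  (∀ g h : H, φ ((g * h) ⊗ₜ[k] (1 : B)) = φ (g ⊗ₜ[k] φ (h ⊗ₜ[k] (1 : B)))) ∧
  (∀ (h : H) (b : B), φ (PiL W h ⊗ₜ[k] b) = φ (h ⊗ₜ[k] (1 : B)) * b)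

/-- `(B, φ)` is a left `H`-module algebra. -/
def IsModAlg (W : HopfData k H) (φ : H ⊗[k] B →ₗ[k] B) : Prop :=
  IsWeakModAlg W φ ∧
    ∀ (g h : H) (b : B), φ ((g * h) ⊗ₜ[k] b) = φ (g ⊗ₜ[k] φ (h ⊗ₜ[k] b))

/-- `(h, hinv)` is a pair of mutually convolution inverse elements in
`Reg_{φ}(H,B)`. -/
def IsRegPair (W : HopfData k H) (φ : H ⊗[k] B →ₗ[k] B) (h hinv : H →ₗ[k] B) : Prop :=
  conv k W.δ h hinv = u1 φ ∧ conv k W.δ hinv h = u1 φ ∧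
  conv k W.δ (conv k W.δ h hinv) h = h ∧
  conv k W.δ (conv k W.δ hinv h) hinv = hinv

end ModAlg

/-- The comultiplication of the tensor product coalgebra `H ⊗ H`. -/
def δ2 (W : HopfData k H) : H ⊗[k] H →ₗ[k] (H ⊗[k] H) ⊗[k] (H ⊗[k] H) :=
  (TensorProduct.tensorTensorTensorComm k H H H H).toLinearMap
    ∘ₗ TensorProduct.map W.δ W.δ

/-- The comultiplication of the tensor product coalgebra `H ⊗ (H ⊗ H)`. -/
def δ3 (W : HopfData k H) :
    H ⊗[k] (H ⊗[k] H) →ₗ[k] (H ⊗[k] (H ⊗[k] H)) ⊗[k] (H ⊗[k] (H ⊗[k] H)) :=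
  (TensorProduct.tensorTensorTensorComm k H H (H ⊗[k] H) (H ⊗[k] H)).toLinearMap
    ∘ₗ TensorProduct.map W.δ (δ2 W)

section ModAlg2

variable {B : Type} [Ring B] [Algebra k B]

/-- `(σ, σinv)` is a pair of mutually convolution inverse elements in
`Reg_{φ}(H⊗H,B)`. -/
def IsRegPair2 (W : HopfData k H) (φ : H ⊗[k] B →ₗ[k] B)
    (σ σinv : H ⊗[k] H →ₗ[k] B) : Prop :=
  conv k (δ2 W) σ σinv = u2 φ ∧ conv k (δ2 W) σinv σ = u2 φ ∧
  conv k (δ2 W) (conv k (δ2 W) σ σinv) σ = σ ∧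
  conv k (δ2 W) (conv k (δ2 W) σinv σ) σinv = σinv

/-- Condition (g1) (the twisted condition). -/
def CrossedG1 (W : HopfData k H) (φ : H ⊗[k] B →ₗ[k] B) (σ : H ⊗[k] H →ₗ[k] B) : Prop :=
  ∀ (x y : H) (b : B),
    LinearMap.mul' k B ((TensorProduct.map σ
        ((φ ∘ₗ (TensorProduct.mk k H B).flip b) ∘ₗ LinearMap.mul' k H))
      (δ2 W (x ⊗ₜ[k] y))) =
    LinearMap.mul' k B ((TensorProduct.map
        (φ ∘ₗ LinearMap.lTensor H (φ ∘ₗ (TensorProduct.mk k H B).flip b)) σ)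
      (δ2 W (x ⊗ₜ[k] y)))

/-- Condition (g2) (the cocycle condition). -/
def CrossedG2 (W : HopfData k H) (φ : H ⊗[k] B →ₗ[k] B) (σ : H ⊗[k] H →ₗ[k] B) : Prop :=
  conv k (δ3 W) (φ ∘ₗ LinearMap.lTensor H σ)
      (σ ∘ₗ LinearMap.lTensor H (LinearMap.mul' k H)) =
  conv k (δ3 W)
      ((TensorProduct.rid k B).toLinearMap ∘ₗ TensorProduct.map σ W.ε
        ∘ₗ (TensorProduct.assoc k H H H).symm.toLinearMap)
      (σ ∘ₗ LinearMap.rTensor H (LinearMap.mul' k H)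
        ∘ₗ (TensorProduct.assoc k H H H).symm.toLinearMap)

/-- Condition (g3) (the normal condition). -/
def CrossedG3 (W : HopfData k H) (φ : H ⊗[k] B →ₗ[k] B) (σ : H ⊗[k] H →ₗ[k] B) : Prop :=
  ∀ h : H, σ (h ⊗ₜ[k] (1 : H)) = u1 φ h ∧ σ ((1 : H) ⊗ₜ[k] h) = u1 φ h

/-- `(φ, σ)` is a crossed system for `H` over `B`, with `σinv` the convolution
inverse of `σ`. -/
def IsCrossedSystem (W : HopfData k H) (φ : H ⊗[k] B →ₗ[k] B)
    (σ σinv : H ⊗[k] H →ₗ[k] B) : Prop :=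
  IsWeakModAlg W φ ∧ IsRegPair2 W φ σ σinv ∧
    CrossedG1 W φ σ ∧ CrossedG2 W φ σ ∧ CrossedG3 W φ σ

/-- The condition that `h` conjugates the weak action `ϕ` into `φ`. -/
def FisEq (W : HopfData k H) (φ ϕ : H ⊗[k] B →ₗ[k] B) (h hinv : H →ₗ[k] B) : Prop :=
  ∀ (g : H) (b : B), φ (g ⊗ₜ[k] b) =
    (LinearMap.mul' k B ∘ₗ LinearMap.rTensor B (LinearMap.mul' k B))
      ((TensorProduct.map (TensorProduct.map h (ϕ ∘ₗ (TensorProduct.mk k H B).flip b)) hinv)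
        ((LinearMap.rTensor H W.δ) (W.δ g)))

/-- The condition that `h` transforms the cocycle `τ` into `σ`. -/
def SigmasEq (W : HopfData k H) (ϕ : H ⊗[k] B →ₗ[k] B)
    (σ τ : H ⊗[k] H →ₗ[k] B) (h hinv : H →ₗ[k] B) : Prop :=
  σ = conv k (δ2 W)
    (LinearMap.mul' k B ∘ₗ TensorProduct.map h ϕ
      ∘ₗ (TensorProduct.assoc k H H B).toLinearMap ∘ₗ TensorProduct.map W.δ h)
    (conv k (δ2 W) τ (hinv ∘ₗ LinearMap.mul' k H))

/-- `h` (with convolution inverse `hinv`) realizes an equivalence between the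
crossed systems `(φ, σ)` and `(ϕ, τ)`. -/
def RealizesEquiv (W : HopfData k H) (φ ϕ : H ⊗[k] B →ₗ[k] B)
    (σ τ : H ⊗[k] H →ₗ[k] B) (h hinv : H →ₗ[k] B) : Prop :=
  IsRegPair W φ h hinv ∧ IsRegPair W ϕ h hinv ∧ h 1 = 1 ∧
    FisEq W φ ϕ h hinv ∧ SigmasEq W ϕ σ τ h hinv

/-- The crossed systems `(φ, σ)` and `(ϕ, τ)` are equivalent. -/
def CrossedEquiv (W : HopfData k H) (φ ϕ : H ⊗[k] B →ₗ[k] B)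
    (σ τ : H ⊗[k] H →ₗ[k] B) : Prop :=
  u1 φ = u1 ϕ ∧ ∃ h hinv : H →ₗ[k] B, RealizesEquiv W φ ϕ σ τ h hinv

/-- The map `ψ_H^B = (φ⊗H)∘(H⊗c_{H,B})∘(δ_H⊗B)`. -/
def ψmap (W : HopfData k H) (φ : H ⊗[k] B →ₗ[k] B) : H ⊗[k] B →ₗ[k] B ⊗[k] H :=
  LinearMap.rTensor H φ
    ∘ₗ (TensorProduct.assoc k H B H).symm.toLinearMap
    ∘ₗ LinearMap.lTensor H (TensorProduct.comm k H B).toLinearMap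
    ∘ₗ (TensorProduct.assoc k H H B).toLinearMap
    ∘ₗ LinearMap.rTensor B W.δ

/-- The map `σ_H^B = (σ⊗μ_H)∘δ_{H⊗H}`. -/
def σHA (W : HopfData k H) (σ : H ⊗[k] H →ₗ[k] B) : H ⊗[k] H →ₗ[k] B ⊗[k] H :=
  TensorProduct.map σ (LinearMap.mul' k H) ∘ₗ δ2 W

/-- The idempotent `∇_{B⊗H} = (μ_B⊗H)∘(B⊗ψ_H^B)∘(B⊗H⊗η_B)`. -/
def nabla (W : HopfData k H) (φ : H ⊗[k] B →ₗ[k] B) : B ⊗[k] H →ₗ[k] B ⊗[k] H :=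
  LinearMap.rTensor H (LinearMap.mul' k B)
    ∘ₗ (TensorProduct.assoc k B B H).symm.toLinearMap
    ∘ₗ LinearMap.lTensor B (ψmap W φ)
    ∘ₗ LinearMap.lTensor B ((TensorProduct.mk k H B).flip 1)

/-- The product `(μ_B⊗H)∘(μ_B⊗σ_H^B)∘(B⊗ψ_H^B⊗H)` on `B ⊗ H`. -/
def crossmulAmb (W : HopfData k H) (φ : H ⊗[k] B →ₗ[k] B) (σ : H ⊗[k] H →ₗ[k] B) :
    (B ⊗[k] H) ⊗[k] (B ⊗[k] H) →ₗ[k] B ⊗[k] H :=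
  LinearMap.rTensor H (LinearMap.mul' k B)
    ∘ₗ (TensorProduct.assoc k B B H).symm.toLinearMap
    ∘ₗ LinearMap.lTensor B (LinearMap.rTensor H (LinearMap.mul' k B))
    ∘ₗ LinearMap.lTensor B ((TensorProduct.assoc k B B H).symm.toLinearMap)
    ∘ₗ LinearMap.lTensor B (LinearMap.lTensor B (σHA W σ))
    ∘ₗ LinearMap.lTensor B ((TensorProduct.assoc k B H H).toLinearMap)
    ∘ₗ LinearMap.lTensor B (LinearMap.rTensor H (ψmap W φ))
    ∘ₗ LinearMap.lTensor B ((TensorProduct.assoc k H B H).symm.toLinearMap)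
    ∘ₗ (TensorProduct.assoc k B H (B ⊗[k] H)).toLinearMap

end ModAlg2

section CrossProd

variable {B : Type} [Ring B] [Algebra k B]
variable {P : Type} [AddCommGroup P] [Module k P]

/-- The product of the weak crossed product `B ×_σ H`, through a splitting
`(P, p, ι)` of the idempotent `∇_{B⊗H}`. -/
def crossMul (W : HopfData k H) (φ : H ⊗[k] B →ₗ[k] B) (σ : H ⊗[k] H →ₗ[k] B)
    (p : B ⊗[k] H →ₗ[k] P) (ι : P →ₗ[k] B ⊗[k] H) : P ⊗[k] P →ₗ[k] P :=
  p ∘ₗ crossmulAmb W φ σ ∘ₗ TensorProduct.map ι ι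

/-- The unit of the weak crossed product `B ×_σ H`. -/
def crossUnit (W : HopfData k H) (φ : H ⊗[k] B →ₗ[k] B)
    (p : B ⊗[k] H →ₗ[k] P) : P :=
  p (nabla W φ ((1 : B) ⊗ₜ[k] (1 : H)))

/-- The coaction `ρ_{B×H} = (p⊗H)∘(B⊗δ_H)∘ι` of the weak crossed product. -/
def crossCoact (W : HopfData k H)
    (p : B ⊗[k] H →ₗ[k] P) (ι : P →ₗ[k] B ⊗[k] H) : P →ₗ[k] P ⊗[k] H :=
  LinearMap.rTensor H p ∘ₗ (TensorProduct.assoc k B H H).symm.toLinearMap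
    ∘ₗ LinearMap.lTensor B W.δ ∘ₗ ι

/-- The inclusion `i_{B×H} = p∘(B⊗η_H) : B → B × H`. -/
def crossInc (p : B ⊗[k] H →ₗ[k] P) : B →ₗ[k] P :=
  p ∘ₗ (TensorProduct.mk k B H).flip 1

/-- The analogue of `ζ` for an abstract module `P` with product `m`:
`ζ(x) = t · (x ⊗ 1)` where `t` plays the role of `ρ(1)`. -/
def zetaGen (m : P ⊗[k] P →ₗ[k] P) (t : P ⊗[k] H) (x : P) : P ⊗[k] H :=
  (TensorProduct.map m (LinearMap.mul' k H))
    ((TensorProduct.tensorTensorTensorComm k P H P H) (t ⊗ₜ[k] (x ⊗ₜ[k] (1 : H))))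

end CrossProd

section Induced

variable {D P : Type} [AddCommGroup D] [Module k D] [AddCommGroup P] [Module k P]

/-- The map `(P⊗P)⊗P → P`, `(x⊗y)⊗z ↦ x·(z·y)`. -/
def mulSwizG (m : P ⊗[k] P →ₗ[k] P) : (P ⊗[k] P) ⊗[k] P →ₗ[k] P :=
  m ∘ₗ LinearMap.lTensor P (m ∘ₗ (TensorProduct.comm k P P).toLinearMap)
    ∘ₗ (TensorProduct.assoc k P P P).toLinearMap

/-- The ambient weak action `μ∘(P⊗(μ∘c))∘(((f⊗f⁻¹)∘δ_H)⊗j) : H ⊗ D → P`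
induced by a cleaving morphism `f`. -/
def phiAmb (W : HopfData k H) (m : P ⊗[k] P →ₗ[k] P) (f finv : H →ₗ[k] P)
    (j : D →ₗ[k] P) : H ⊗[k] D →ₗ[k] P :=
  mulSwizG m ∘ₗ TensorProduct.map ((TensorProduct.map f finv) ∘ₗ W.δ) j

/-- The ambient cocycle `(μ∘(f⊗f)) ∧ (f⁻¹∘μ_H) : H ⊗ H → P` induced by a
cleaving morphism `f`. -/
def sigmaAmb (W : HopfData k H) (m : P ⊗[k] P →ₗ[k] P) (f finv : H →ₗ[k] P) :
    H ⊗[k] H →ₗ[k] P :=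
  convG k (δ2 W) m (m ∘ₗ TensorProduct.map f f) (finv ∘ₗ LinearMap.mul' k H)

end Induced

section Pres

variable {A D : Type} [Ring A] [Algebra k A] [Ring D] [Algebra k D]

/-- `j : D → A` presents `D` as the subalgebra of coinvariants of `A`. -/
def IsCoinvPres (ρ : A →ₗ[k] A ⊗[k] H) (j : D →ₐ[k] A) : Prop :=
  Function.Injective j ∧ ∀ a : A, IsCoinv ρ a ↔ a ∈ Set.range j

end Pres

section SweedlerPairing

variable {C L M N Q Q' : Type} [AddCommGroup C] [Module k C] [AddCommGroup L] [Module k L]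
  [AddCommGroup M] [Module k M] [AddCommGroup N] [Module k N] [AddCommGroup Q] [Module k Q]
  [AddCommGroup Q'] [Module k Q']

/-- The map `c ↦ Σ β (X c₁) (Y c₂)`, where `δC c = Σ c₁ ⊗ c₂`. -/
def pairing (δC : C →ₗ[k] C ⊗[k] C) (β : M →ₗ[k] N →ₗ[k] Q) (X : C →ₗ[k] M) (Y : C →ₗ[k] N) :
    C →ₗ[k] Q :=
  TensorProduct.lift β ∘ₗ TensorProduct.map X Y ∘ₗ δC

/-- Coassociativity of a comultiplication. -/
def Coassoc (δC : C →ₗ[k] C ⊗[k] C) : Prop :=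
  ∀ c, TensorProduct.assoc k C C C (LinearMap.rTensor C δC (δC c)) = LinearMap.lTensor C δC (δC c)

theorem pairing_apply_of_eq_sum (δC : C →ₗ[k] C ⊗[k] C) (β : M →ₗ[k] N →ₗ[k] Q)
    (X : C →ₗ[k] M) (Y : C →ₗ[k] N) {c : C} {s : Finset (C × C)}
    (hs : δC c = ∑ i ∈ s, i.1 ⊗ₜ[k] i.2) :
    pairing δC β X Y c = ∑ i ∈ s, β (X i.1) (Y i.2) := by
  simp [pairing, hs]

theorem pairing_assoc {δC : C →ₗ[k] C ⊗[k] C} (hδ : Coassoc δC)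
    {L' : Type} [AddCommGroup L'] [Module k L']
    (β' : L →ₗ[k] M →ₗ[k] L') (β : L' →ₗ[k] N →ₗ[k] Q)
    (γ' : M →ₗ[k] N →ₗ[k] Q') (γ : L →ₗ[k] Q' →ₗ[k] Q)
    (hβγ : ∀ x y z, β (β' x y) z = γ x (γ' y z))
    (X : C →ₗ[k] L) (Y : C →ₗ[k] M) (Z : C →ₗ[k] N) :
    pairing δC β (pairing δC β' X Y) Z = pairing δC γ X (pairing δC γ' Y Z) := by
  ext c
  let G : C ⊗[k] (C ⊗[k] C) →ₗ[k] Q := TensorProduct.lift γ ∘ₗ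
    TensorProduct.map X (TensorProduct.lift γ' ∘ₗ TensorProduct.map Y Z)
  have hl : pairing δC γ X (pairing δC γ' Y Z) c = G (LinearMap.lTensor C δC (δC c)) := by
    obtain ⟨s, hs⟩ := TensorProduct.exists_finset (δC c)
    simp [pairing, hs, G]
  have hr : pairing δC β (pairing δC β' X Y) Z c =
      (G ∘ₗ (TensorProduct.assoc k C C C).toLinearMap) (LinearMap.rTensor C δC (δC c)) := by
    obtain ⟨s, hs⟩ := TensorProduct.exists_finset (δC c)
    simp only [pairing, hs, LinearMap.comp_apply, map_sum, TensorProduct.map_tmul,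
      LinearMap.rTensor_tmul, TensorProduct.lift.tmul]
    refine Finset.sum_congr rfl fun i _ => ?_
    obtain ⟨t, ht⟩ := TensorProduct.exists_finset (δC i.1)
    simp [ht, G, TensorProduct.sum_tmul, hβγ]
  rw [hl, hr, LinearMap.comp_apply, LinearEquiv.coe_coe, hδ c]

theorem map_pairing (δC : C →ₗ[k] C ⊗[k] C) (β : M →ₗ[k] N →ₗ[k] Q) (γ : M →ₗ[k] L →ₗ[k] Q')
    (F : Q →ₗ[k] Q') (G : N →ₗ[k] L) (h : ∀ x y, F (β x y) = γ x (G y))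
    (X : C →ₗ[k] M) (Y : C →ₗ[k] N) :
    F ∘ₗ pairing δC β X Y = pairing δC γ X (G ∘ₗ Y) := by
  ext c
  obtain ⟨s, hs⟩ := TensorProduct.exists_finset (δC c)
  simp [pairing_apply_of_eq_sum _ _ _ _ hs, h]

theorem pairing_sum_right (δC : C →ₗ[k] C ⊗[k] C) (β : M →ₗ[k] N →ₗ[k] Q) (X : C →ₗ[k] M)
    {ι : Type} (s : Finset ι) (Y : ι → C →ₗ[k] N) :
    pairing δC β X (∑ i ∈ s, Y i) = ∑ i ∈ s, pairing δC β X (Y i) := by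
  ext c
  obtain ⟨t, ht⟩ := TensorProduct.exists_finset (δC c)
  simp only [pairing_apply_of_eq_sum _ _ _ _ ht, LinearMap.sum_apply, map_sum]
  exact Finset.sum_comm

theorem convG_eq_pairing (δC : C →ₗ[k] C ⊗[k] C) (m : M ⊗[k] M →ₗ[k] M) (X Y : C →ₗ[k] M) :
    convG k δC m X Y = pairing δC (TensorProduct.curry m) X Y := by
  rw [convG, pairing, show TensorProduct.lift (TensorProduct.curry m) = m from
    TensorProduct.ext' fun _ _ => rfl]

theorem conv_eq_pairing {A : Type} [Ring A] [Algebra k A] (δC : C →ₗ[k] C ⊗[k] C)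
    (X Y : C →ₗ[k] A) : conv k δC X Y = pairing δC (LinearMap.mul k A) X Y :=
  rfl

theorem pairing_δ2_of_right (W : HopfData k H) (β : M →ₗ[k] N →ₗ[k] Q)
    (X : H ⊗[k] H →ₗ[k] M) (Y : H ⊗[k] H →ₗ[k] N) {h : H} {s : Finset (H × H)}
    (hs : W.δ h = ∑ i ∈ s, i.1 ⊗ₜ[k] i.2) (g : H) :
    pairing (δ2 W) β X Y (g ⊗ₜ h) = ∑ i ∈ s,
      pairing W.δ β (X ∘ₗ (TensorProduct.mk k H H).flip i.1)
        (Y ∘ₗ (TensorProduct.mk k H H).flip i.2) g := by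
  obtain ⟨t, ht⟩ := TensorProduct.exists_finset (W.δ g)
  simp only [pairing_apply_of_eq_sum _ _ _ _ ht]
  simp only [pairing, δ2, hs, ht, LinearMap.comp_apply, TensorProduct.map_tmul,
    TensorProduct.sum_tmul, TensorProduct.tmul_sum, map_sum, LinearEquiv.coe_coe,
    TensorProduct.tensorTensorTensorComm_tmul, TensorProduct.lift.tmul, LinearMap.flip_apply,
    TensorProduct.mk_apply]

theorem pairing_δ2_of_left (W : HopfData k H) (β : M →ₗ[k] N →ₗ[k] Q)
    (X : H ⊗[k] H →ₗ[k] M) (Y : H ⊗[k] H →ₗ[k] N) {g : H} {s : Finset (H × H)}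
    (hs : W.δ g = ∑ i ∈ s, i.1 ⊗ₜ[k] i.2) (h : H) :
    pairing (δ2 W) β X Y (g ⊗ₜ h) = ∑ i ∈ s,
      pairing W.δ β (X ∘ₗ TensorProduct.mk k H H i.1) (Y ∘ₗ TensorProduct.mk k H H i.2) h := by
  obtain ⟨t, ht⟩ := TensorProduct.exists_finset (W.δ h)
  simp only [pairing_apply_of_eq_sum _ _ _ _ ht]
  simp only [pairing, δ2, hs, ht, LinearMap.comp_apply, TensorProduct.map_tmul,
    TensorProduct.sum_tmul, TensorProduct.tmul_sum, map_sum, LinearEquiv.coe_coe,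
    TensorProduct.tensorTensorTensorComm_tmul, TensorProduct.lift.tmul,
    TensorProduct.mk_apply]
  exact Finset.sum_comm

end SweedlerPairing

section WeakHopf

variable {W : HopfData k H}

theorem IsWeakHopf.coassoc_δ (hW : IsWeakHopf W) : Coassoc W.δ := hW.coassoc

theorem IsWeakHopf.coassoc_δ2 (hW : IsWeakHopf W) : Coassoc (δ2 W) := by
  let _ : Coalgebra k H :=
    { comul := W.δ
      counit := W.ε
      coassoc := LinearMap.ext hW.coassoc
      rTensor_counit_comp_comul := LinearMap.ext fun h =>
        (TensorProduct.lid k H).injective (by simpa using hW.counit_left h)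
      lTensor_counit_comp_comul := LinearMap.ext fun h =>
        (TensorProduct.rid k H).injective (by simpa using hW.counit_right h) }
  exact Coalgebra.coassoc_apply (R := k) (A := H ⊗[k] H)

theorem pairing_δ2_comp_mul' (hW : IsWeakHopf W) {M N Q : Type} [AddCommGroup M] [Module k M]
    [AddCommGroup N] [Module k N] [AddCommGroup Q] [Module k Q]
    (β : M →ₗ[k] N →ₗ[k] Q) (X : H →ₗ[k] M) (Y : H →ₗ[k] N) :
    pairing (δ2 W) β (X ∘ₗ LinearMap.mul' k H) (Y ∘ₗ LinearMap.mul' k H) =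
      pairing W.δ β X Y ∘ₗ LinearMap.mul' k H := by
  ext g h
  obtain ⟨s, hs⟩ := TensorProduct.exists_finset (W.δ g)
  obtain ⟨t, ht⟩ := TensorProduct.exists_finset (W.δ h)
  simp [pairing, δ2, hW.a1, hs, ht, TensorProduct.sum_tmul, TensorProduct.tmul_sum,
    Finset.sum_mul, Finset.mul_sum]

/-- `1₁ ⊗ δ(1₂) = 1₁ ⊗ (1₂ ⊗ 1)δ(1)`. -/
theorem IsWeakHopf.lTensor_δ_one (hW : IsWeakHopf W) :
    LinearMap.lTensor H W.δ (W.δ 1) =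
      LinearMap.lTensor H (LinearMap.mulRight k (W.δ 1) ∘ₗ
        (Algebra.TensorProduct.includeLeft : H →ₐ[k] H ⊗[k] H).toLinearMap) (W.δ 1) := by
  rw [← hW.coassoc 1, hW.a3]
  generalize W.δ 1 = t
  obtain ⟨s, hs⟩ := TensorProduct.exists_finset t
  simp only [hs, map_sum, Finset.sum_mul]
  simp [Finset.mul_sum, TensorProduct.tmul_sum]

theorem pairing_comp_δ_one (hW : IsWeakHopf W) {M N Q : Type} [AddCommGroup M] [Module k M]
    [AddCommGroup N] [Module k N] [AddCommGroup Q] [Module k Q]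
    (β : M →ₗ[k] N →ₗ[k] Q) (X : H →ₗ[k] M) (Z : H ⊗[k] H →ₗ[k] N) :
    pairing W.δ β X (Z ∘ₗ W.δ) 1 =
      pairing W.δ β X (Z ∘ₗ LinearMap.mulRight k (W.δ 1) ∘ₗ
        (Algebra.TensorProduct.includeLeft : H →ₐ[k] H ⊗[k] H).toLinearMap) 1 := by
  have key := congrArg (TensorProduct.lift β ∘ₗ TensorProduct.map X Z) hW.lTensor_δ_one
  simpa only [LinearMap.comp_apply, LinearMap.lTensor_def, TensorProduct.map_map, pairing,
    LinearMap.comp_id] using key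

/-- `δ(Π^L(h)) = (Π^L(h) ⊗ 1)δ(1)`. -/
theorem δ_PiL (hW : IsWeakHopf W) (h : H) :
    W.δ (PiL W h) = (PiL W h ⊗ₜ[k] (1 : H)) * W.δ 1 := by
  have hP : ∀ (F : H →ₗ[k] H ⊗[k] H), F (PiL W h) =
      pairing W.δ (LinearMap.lsmul k (H ⊗[k] H)) (W.ε ∘ₗ LinearMap.mulRight k h) F 1 := by
    intro F
    obtain ⟨s, hs⟩ := TensorProduct.exists_finset (W.δ 1)
    rw [pairing_apply_of_eq_sum _ _ _ _ hs]
    simp [PiL, hs]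
  have h2 := hP (LinearMap.mulRight k (W.δ 1) ∘ₗ
        (Algebra.TensorProduct.includeLeft : H →ₐ[k] H ⊗[k] H).toLinearMap)
  have h3 := pairing_comp_δ_one hW (LinearMap.lsmul k (H ⊗[k] H)) (W.ε ∘ₗ LinearMap.mulRight k h)
    LinearMap.id
  rw [LinearMap.id_comp, LinearMap.id_comp] at h3
  rw [hP W.δ, h3, ← h2]
  simp

end WeakHopf

section CrossedProduct

variable {A : Type} [Ring A] [Algebra k A]

variable (k H A) in
/-- The left `A`-action `a • z = (a ⊗ 1) z` on `A ⊗ H`. -/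
def leftMul : A →ₗ[k] A ⊗[k] H →ₗ[k] A ⊗[k] H :=
  LinearMap.mul k (A ⊗[k] H) ∘ₗ
    (Algebra.TensorProduct.includeLeft : A →ₐ[k] A ⊗[k] H).toLinearMap

theorem leftMul_apply (a : A) (z : A ⊗[k] H) :
    leftMul k H A a z = (a ⊗ₜ[k] (1 : H)) * z := rfl

theorem leftMul_tmul (a b : A) (h : H) :
    leftMul k H A a (b ⊗ₜ[k] h) = (a * b) ⊗ₜ[k] h := by
  simp [leftMul_apply]

theorem leftMul_leftMul (a b : A) (z : A ⊗[k] H) :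
    leftMul k H A a (leftMul k H A b z) = leftMul k H A (a * b) z := by
  simp [leftMul_apply, ← mul_assoc]

theorem leftMul_one (z : A ⊗[k] H) : leftMul k H A 1 z = z := by
  rw [leftMul_apply, ← Algebra.TensorProduct.one_def, one_mul]

theorem rTensor_mul'_assoc_symm (a : A) (z : A ⊗[k] H) :
    LinearMap.rTensor H (LinearMap.mul' k A) ((TensorProduct.assoc k A A H).symm (a ⊗ₜ z)) =
      leftMul k H A a z := by
  obtain ⟨s, hs⟩ := TensorProduct.exists_finset z
  simp [hs, TensorProduct.tmul_sum, leftMul_tmul]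

/-- The map `h ↦ φ (h ⊗ b)`. -/
def actOn (φ : H ⊗[k] A →ₗ[k] A) (b : A) : H →ₗ[k] A := φ ∘ₗ (TensorProduct.mk k H A).flip b

variable {W : HopfData k H} {φ : H ⊗[k] A →ₗ[k] A} {σ σinv : H ⊗[k] H →ₗ[k] A}

theorem actOn_apply (b : A) (h : H) : actOn φ b h = φ (h ⊗ₜ b) := rfl

theorem u1_apply (h : H) : u1 φ h = φ (h ⊗ₜ 1) := rfl

theorem ψmap_tmul (h : H) (b : A) :
    ψmap W φ (h ⊗ₜ b) = LinearMap.rTensor H (actOn φ b) (W.δ h) := by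
  obtain ⟨s, hs⟩ := TensorProduct.exists_finset (W.δ h)
  simp [ψmap, hs, TensorProduct.sum_tmul, actOn]

theorem nabla_tmul (a : A) (h : H) :
    nabla W φ (a ⊗ₜ h) = leftMul k H A a (LinearMap.rTensor H (u1 φ) (W.δ h)) := by
  simp only [nabla, LinearMap.comp_apply, LinearMap.lTensor_tmul, LinearMap.flip_apply,
    TensorProduct.mk_apply, ψmap_tmul, LinearEquiv.coe_coe]
  exact rTensor_mul'_assoc_symm _ _

theorem nabla_leftMul (a : A) (z : A ⊗[k] H) :
    nabla W φ (leftMul k H A a z) = leftMul k H A a (nabla W φ z) := by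
  obtain ⟨s, rfl⟩ := TensorProduct.exists_finset z
  simp [leftMul_tmul, nabla_tmul, leftMul_leftMul]

theorem crossmulAmb_tmul (a b : A) (g h : H) :
    crossmulAmb W φ σ ((a ⊗ₜ g) ⊗ₜ (b ⊗ₜ h)) =
      leftMul k H A a (pairing W.δ (leftMul k H A) (actOn φ b)
        (σHA W σ ∘ₗ (TensorProduct.mk k H H).flip h) g) := by
  obtain ⟨s, hs⟩ := TensorProduct.exists_finset (W.δ g)
  rw [pairing_apply_of_eq_sum _ _ _ _ hs]
  simp only [crossmulAmb, LinearMap.comp_apply, LinearMap.lTensor_tmul, LinearEquiv.coe_coe,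
    TensorProduct.assoc_tmul, TensorProduct.assoc_symm_tmul, LinearMap.rTensor_tmul, ψmap_tmul, hs,
    map_sum, TensorProduct.sum_tmul, TensorProduct.tmul_sum, rTensor_mul'_assoc_symm,
    LinearMap.flip_apply, TensorProduct.mk_apply]

theorem crossmulAmb_leftMul (a : A) (z w : A ⊗[k] H) :
    crossmulAmb W φ σ (leftMul k H A a z ⊗ₜ w) =
      leftMul k H A a (crossmulAmb W φ σ (z ⊗ₜ w)) := by
  obtain ⟨s, rfl⟩ := TensorProduct.exists_finset z
  obtain ⟨t, rfl⟩ := TensorProduct.exists_finset w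
  simp [TensorProduct.sum_tmul, TensorProduct.tmul_sum, leftMul_tmul, crossmulAmb_tmul,
    leftMul_leftMul]

theorem σHA_eq_pairing :
    σHA W σ = pairing (δ2 W) (TensorProduct.mk k A H) σ (LinearMap.mul' k H) := by
  rw [σHA, pairing, show TensorProduct.lift (TensorProduct.mk k A H) = LinearMap.id from
    TensorProduct.ext' fun _ _ => rfl, LinearMap.id_comp]

theorem rTensor_comp_δ_eq_pairing {M : Type} [AddCommGroup M] [Module k M] (X : H →ₗ[k] M) :
    LinearMap.rTensor H X ∘ₗ W.δ = pairing W.δ (TensorProduct.mk k M H) X LinearMap.id := by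
  rw [pairing, show TensorProduct.lift (TensorProduct.mk k M H) = LinearMap.id from
    TensorProduct.ext' fun _ _ => rfl, LinearMap.id_comp]
  rfl

theorem IsWeakModAlg.pairing_actOn (hφ : IsWeakModAlg W φ) (b c : A) :
    pairing W.δ (LinearMap.mul k A) (actOn φ b) (actOn φ c) = actOn φ (b * c) :=
  LinearMap.ext fun h => (hφ.2.1 h b c).symm

theorem IsWeakModAlg.u1_mul (hφ : IsWeakModAlg W φ) (h : H) :
    u1 φ ∘ₗ LinearMap.mulRight k h = actOn φ (u1 φ h) :=
  LinearMap.ext fun g => hφ.2.2.1 g h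

theorem pairing_leftMul_assoc {C : Type} [AddCommGroup C] [Module k C] {δC : C →ₗ[k] C ⊗[k] C}
    (hδ : Coassoc δC) (X Y : C →ₗ[k] A) (Z : C →ₗ[k] A ⊗[k] H) :
    pairing δC (leftMul k H A) (pairing δC (LinearMap.mul k A) X Y) Z =
      pairing δC (leftMul k H A) X (pairing δC (leftMul k H A) Y Z) :=
  pairing_assoc hδ _ _ _ _ (fun a b z => (leftMul_leftMul a b z).symm) X Y Z

theorem pairing_mk_assoc {C : Type} [AddCommGroup C] [Module k C] {δC : C →ₗ[k] C ⊗[k] C}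
    (hδ : Coassoc δC) (X Y : C →ₗ[k] A) (Z : C →ₗ[k] H) :
    pairing δC (TensorProduct.mk k A H) (pairing δC (LinearMap.mul k A) X Y) Z =
      pairing δC (leftMul k H A) X (pairing δC (TensorProduct.mk k A H) Y Z) :=
  pairing_assoc hδ _ _ _ _ (fun a b z => (leftMul_tmul a b z).symm) X Y Z

theorem pairing_mul_assoc {C : Type} [AddCommGroup C] [Module k C] {δC : C →ₗ[k] C ⊗[k] C}
    (hδ : Coassoc δC) (X Y Z : C →ₗ[k] A) :
    pairing δC (LinearMap.mul k A) (pairing δC (LinearMap.mul k A) X Y) Z =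
      pairing δC (LinearMap.mul k A) X (pairing δC (LinearMap.mul k A) Y Z) :=
  pairing_assoc hδ _ _ _ _ (fun a b c => mul_assoc a b c) X Y Z

theorem pairing_u2_left (hσ : IsRegPair2 W φ σ σinv) :
    pairing (δ2 W) (LinearMap.mul k A) (u2 φ) σ = σ := by
  have h := hσ.2.2.1
  rwa [hσ.1, conv_eq_pairing] at h

theorem pairing_u2_right (hW : IsWeakHopf W) (hσ : IsRegPair2 W φ σ σinv) :
    pairing (δ2 W) (LinearMap.mul k A) σ (u2 φ) = σ := by
  have h := hσ.2.2.1
  rwa [conv_eq_pairing, conv_eq_pairing, pairing_mul_assoc hW.coassoc_δ2, ← conv_eq_pairing (Y := σ),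
    hσ.2.1] at h

theorem pairing_u2_σHA (hW : IsWeakHopf W) (hσ : IsRegPair2 W φ σ σinv) :
    pairing (δ2 W) (leftMul k H A) (u2 φ) (σHA W σ) = σHA W σ := by
  rw [σHA_eq_pairing, ← pairing_mk_assoc hW.coassoc_δ2, pairing_u2_left hσ]

/-- `Σ (g₁ · u₁(h₁)) σHA(g₂ ⊗ h₂) = σHA(g ⊗ h)`. -/
theorem sum_pairing_actOn_σHA (hW : IsWeakHopf W) (hφ : IsWeakModAlg W φ)
    (hσ : IsRegPair2 W φ σ σinv) {h : H} {s : Finset (H × H)}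
    (hs : W.δ h = ∑ i ∈ s, i.1 ⊗ₜ[k] i.2) :
    ∑ i ∈ s, pairing W.δ (leftMul k H A) (actOn φ (u1 φ i.1))
      (σHA W σ ∘ₗ (TensorProduct.mk k H H).flip i.2) =
      σHA W σ ∘ₗ (TensorProduct.mk k H H).flip h := by
  ext g
  have key := congrArg (fun X => X (g ⊗ₜ[k] h)) (pairing_u2_σHA hW hσ)
  simp only [pairing_δ2_of_right W _ _ _ hs] at key
  rw [LinearMap.sum_apply, LinearMap.comp_apply, LinearMap.flip_apply, TensorProduct.mk_apply, ← key]
  refine Finset.sum_congr rfl fun i _ => ?_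
  rw [← hφ.u1_mul]
  rfl

/-- `Σ u₁(g₁) σHA(g₂ ⊗ h) = σHA(g ⊗ h)`. -/
theorem pairing_u1_σHA (hW : IsWeakHopf W) (hφ : IsWeakModAlg W φ)
    (hσ : IsRegPair2 W φ σ σinv) (h : H) :
    pairing W.δ (leftMul k H A) (actOn φ 1) (σHA W σ ∘ₗ (TensorProduct.mk k H H).flip h) =
      σHA W σ ∘ₗ (TensorProduct.mk k H H).flip h := by
  obtain ⟨s, hs⟩ := TensorProduct.exists_finset (W.δ h)
  simp only [← sum_pairing_actOn_σHA hW hφ hσ hs, pairing_sum_right,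
    ← pairing_leftMul_assoc hW.coassoc_δ, hφ.pairing_actOn, one_mul]

theorem crossmulAmb_nabla_left (hW : IsWeakHopf W) (hφ : IsWeakModAlg W φ) (z w : A ⊗[k] H) :
    crossmulAmb W φ σ (nabla W φ z ⊗ₜ w) = crossmulAmb W φ σ (z ⊗ₜ w) := by
  obtain ⟨s, rfl⟩ := TensorProduct.exists_finset z
  obtain ⟨t, rfl⟩ := TensorProduct.exists_finset w
  simp only [map_sum, TensorProduct.sum_tmul, TensorProduct.tmul_sum]
  refine Finset.sum_congr rfl fun i _ => Finset.sum_congr rfl fun j _ => ?_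
  rw [nabla_tmul, crossmulAmb_leftMul, crossmulAmb_tmul]
  congr 1
  obtain ⟨r, hr⟩ := TensorProduct.exists_finset (W.δ j.2)
  rw [← one_mul i.1, ← hφ.pairing_actOn, pairing_leftMul_assoc hW.coassoc_δ, one_mul]
  rw [pairing_apply_of_eq_sum _ _ _ _ hr, hr]
  simp only [map_sum, TensorProduct.sum_tmul, LinearMap.rTensor_tmul, crossmulAmb_tmul]
  rfl

theorem crossmulAmb_nabla_right (hW : IsWeakHopf W) (hφ : IsWeakModAlg W φ)
    (hσ : IsRegPair2 W φ σ σinv) (z w : A ⊗[k] H) :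
    crossmulAmb W φ σ (z ⊗ₜ nabla W φ w) = crossmulAmb W φ σ (z ⊗ₜ w) := by
  obtain ⟨s, rfl⟩ := TensorProduct.exists_finset z
  obtain ⟨t, rfl⟩ := TensorProduct.exists_finset w
  simp only [map_sum, TensorProduct.sum_tmul, TensorProduct.tmul_sum]
  refine Finset.sum_congr rfl fun i _ => Finset.sum_congr rfl fun j _ => ?_
  obtain ⟨r, hr⟩ := TensorProduct.exists_finset (W.δ i.2)
  simp only [nabla_tmul, hr, map_sum, TensorProduct.tmul_sum, LinearMap.rTensor_tmul,
    leftMul_tmul, crossmulAmb_tmul, ← hφ.pairing_actOn, pairing_leftMul_assoc hW.coassoc_δ]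
  rw [← sum_pairing_actOn_σHA hW hφ hσ hr, pairing_sum_right, LinearMap.sum_apply, map_sum]

/-- `(1₁ · b) ⊗ 1₂ = b u₁(1₁) ⊗ 1₂`. -/
theorem rTensor_actOn_δ_one (hW : IsWeakHopf W) (hφ : IsWeakModAlg W φ) (b : A) :
    LinearMap.rTensor H (actOn φ b) (W.δ 1) =
      leftMul k H A b (LinearMap.rTensor H (u1 φ) (W.δ 1)) := by
  obtain ⟨s, hs⟩ := TensorProduct.exists_finset (W.δ 1)
  have hb : actOn φ b = pairing W.δ (LinearMap.mul k A) (actOn φ b) (u1 φ) := by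
    conv_lhs => rw [← mul_one b, ← hφ.pairing_actOn]
    rfl
  rw [← LinearMap.comp_apply, rTensor_comp_δ_eq_pairing, hb, pairing_mk_assoc hW.coassoc_δ,
    ← rTensor_comp_δ_eq_pairing, pairing_comp_δ_one hW]
  have hR : (LinearMap.rTensor H (u1 φ) ∘ₗ LinearMap.mulRight k (W.δ 1) ∘ₗ
        (Algebra.TensorProduct.includeLeft : H →ₐ[k] H ⊗[k] H).toLinearMap) =
      ∑ i ∈ s, (TensorProduct.mk k A H).flip i.2 ∘ₗ actOn φ (u1 φ i.1) := by
    ext x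
    simp [hs, Finset.mul_sum, ← hφ.u1_mul]
  rw [hR, pairing_sum_right, hs]
  simp only [LinearMap.sum_apply, map_sum, LinearMap.rTensor_tmul, leftMul_tmul]
  refine Finset.sum_congr rfl fun i _ => ?_
  have := map_pairing W.δ (LinearMap.mul k A) (leftMul k H A)
    ((TensorProduct.mk k A H).flip i.2) ((TensorProduct.mk k A H).flip i.2)
    (fun x y => (leftMul_tmul x y i.2).symm) (actOn φ b) (actOn φ (u1 φ i.1))
  rw [← this, hφ.pairing_actOn, LinearMap.comp_apply, actOn_apply, hφ.1]
  rfl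

theorem pairing_actOn_one (hW : IsWeakHopf W) (hφ : IsWeakModAlg W φ) (b : A)
    (Z : H →ₗ[k] A ⊗[k] H) :
    pairing W.δ (leftMul k H A) (actOn φ b) Z 1 =
      leftMul k H A b (pairing W.δ (leftMul k H A) (actOn φ 1) Z 1) := by
  let G : A ⊗[k] H →ₗ[k] A ⊗[k] H := TensorProduct.lift ((leftMul k H A).compl₂ Z)
  have hG : ∀ c, pairing W.δ (leftMul k H A) (actOn φ c) Z 1 =
      G (LinearMap.rTensor H (actOn φ c) (W.δ 1)) := by
    intro c
    obtain ⟨s, hs⟩ := TensorProduct.exists_finset (W.δ 1)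
    rw [pairing_apply_of_eq_sum _ _ _ _ hs]
    simp [hs, G]
  have hGl : ∀ z, G (leftMul k H A b z) = leftMul k H A b (G z) := by
    intro z
    obtain ⟨s, rfl⟩ := TensorProduct.exists_finset z
    simp [leftMul_tmul, G, leftMul_leftMul]
  rw [hG, hG, rTensor_actOn_δ_one hW hφ b, hGl]
  rfl

/-- `Σ σ(1₁ ⊗ h₁) ⊗ 1₂h₂ = Σ u₁(h₁) ⊗ h₂`. -/
theorem σHA_one_tmul (hW : IsWeakHopf W) (hσ : IsRegPair2 W φ σ σinv) (h3 : CrossedG3 W φ σ)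
    (h : H) : σHA W σ (1 ⊗ₜ h) = LinearMap.rTensor H (u1 φ) (W.δ h) := by
  obtain ⟨s, hs⟩ := TensorProduct.exists_finset (W.δ h)
  obtain ⟨t, ht⟩ := TensorProduct.exists_finset (W.δ 1)
  have hu : pairing (δ2 W) (TensorProduct.mk k A H) (u2 φ) (LinearMap.mul' k H) =
      LinearMap.rTensor H (u1 φ) ∘ₗ W.δ ∘ₗ LinearMap.mul' k H := by
    rw [← LinearMap.comp_assoc, rTensor_comp_δ_eq_pairing, ← pairing_δ2_comp_mul' hW]
    rfl
  let T : H ⊗[k] H →ₗ[k] A ⊗[k] H := LinearMap.rTensor H (u1 φ) ∘ₗ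
    LinearMap.mul' k (H ⊗[k] H) ∘ₗ TensorProduct.map
      (Algebra.TensorProduct.includeLeft : H →ₐ[k] H ⊗[k] H).toLinearMap W.δ
  have hT : σHA W σ (1 ⊗ₜ h) = pairing (δ2 W) (leftMul k H A) σ T (1 ⊗ₜ h) := by
    rw [σHA_eq_pairing, ← pairing_u2_right hW hσ, pairing_mk_assoc hW.coassoc_δ2, hu,
      pairing_u2_right hW hσ, pairing_δ2_of_right W _ _ _ hs, pairing_δ2_of_right W _ _ _ hs]
    refine Finset.sum_congr rfl fun i _ => ?_
    have key := pairing_comp_δ_one hW (leftMul k H A) (σ ∘ₗ (TensorProduct.mk k H H).flip i.1)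
      (LinearMap.rTensor H (u1 φ) ∘ₗ LinearMap.mulRight k (W.δ i.2))
    convert key using 2
    · congr 1
      ext x
      simp [hW.a1]
    · congr 1
      ext x
      simp only [T, LinearMap.comp_apply, LinearMap.flip_apply, TensorProduct.mk_apply,
        TensorProduct.map_tmul, LinearMap.mul'_apply, LinearMap.mulRight_apply, mul_assoc,
        ← hW.a1, one_mul]
  have hσ1 : u1 φ = σ ∘ₗ TensorProduct.mk k H H 1 := LinearMap.ext fun x => (h3 x).2.symm
  rw [hT, pairing_δ2_of_left W _ _ _ ht, hσ1, ← LinearMap.comp_apply, rTensor_comp_δ_eq_pairing,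
    ← pairing_u2_right hW hσ]
  have hsum : pairing (δ2 W) (LinearMap.mul k A) σ (u2 φ) ∘ₗ TensorProduct.mk k H H 1 =
      ∑ i ∈ t, pairing W.δ (LinearMap.mul k A) (σ ∘ₗ TensorProduct.mk k H H i.1)
        (u2 φ ∘ₗ TensorProduct.mk k H H i.2) := by
    ext x
    rw [LinearMap.comp_apply, TensorProduct.mk_apply, pairing_δ2_of_left W _ _ _ ht,
      LinearMap.sum_apply]
  rw [hsum, pairing_u2_right hW hσ]
  have hl : ∀ X : H × H → H →ₗ[k] A,
      pairing W.δ (TensorProduct.mk k A H) (∑ i ∈ t, X i) LinearMap.id =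
        ∑ i ∈ t, pairing W.δ (TensorProduct.mk k A H) (X i) LinearMap.id := by
    intro X
    ext x
    obtain ⟨r, hr⟩ := TensorProduct.exists_finset (W.δ x)
    simp only [pairing_apply_of_eq_sum _ _ _ _ hr, LinearMap.sum_apply, map_sum]
    exact Finset.sum_comm
  rw [hl, LinearMap.sum_apply]
  refine Finset.sum_congr rfl fun i _ => ?_
  rw [pairing_mk_assoc hW.coassoc_δ]
  congr 2
  ext y
  obtain ⟨r, hr⟩ := TensorProduct.exists_finset (W.δ y)
  rw [pairing_apply_of_eq_sum _ _ _ _ hr]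
  simp [T, hr, Finset.mul_sum, u2]

section Splitting

variable {P : Type} [AddCommGroup P] [Module k P]
  {p : A ⊗[k] H →ₗ[k] P} {ι : P →ₗ[k] A ⊗[k] H}

/-- The left `A`-action on a splitting `(P, p, ι)` of the idempotent `∇`. -/
def splitAct (p : A ⊗[k] H →ₗ[k] P) (ι : P →ₗ[k] A ⊗[k] H) : A →ₗ[k] P →ₗ[k] P :=
  ((leftMul k H A).compl₂ ι).compr₂ p

theorem splitAct_apply (a : A) (x : P) :
    splitAct p ι a x = p (leftMul k H A a (ι x)) := rfl

theorem split_nabla (hsplit : ι ∘ₗ p = nabla W φ) (hretr : p ∘ₗ ι = LinearMap.id)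
    (z : A ⊗[k] H) : p (nabla W φ z) = p z := by
  rw [← hsplit]
  exact LinearMap.congr_fun hretr (p z)

theorem splitAct_split (hsplit : ι ∘ₗ p = nabla W φ) (hretr : p ∘ₗ ι = LinearMap.id)
    (a : A) (z : A ⊗[k] H) : splitAct p ι a (p z) = p (leftMul k H A a z) := by
  rw [splitAct_apply, ← LinearMap.comp_apply ι p, hsplit, ← nabla_leftMul,
    split_nabla hsplit hretr]

theorem split_surjective (hretr : p ∘ₗ ι = LinearMap.id) : Function.Surjective p :=
  fun x => ⟨ι x, LinearMap.congr_fun hretr x⟩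

theorem crossMul_split (hW : IsWeakHopf W) (hφ : IsWeakModAlg W φ)
    (hσ : IsRegPair2 W φ σ σinv) (hsplit : ι ∘ₗ p = nabla W φ) (z w : A ⊗[k] H) :
    crossMul W φ σ p ι (p z ⊗ₜ p w) = p (crossmulAmb W φ σ (z ⊗ₜ w)) := by
  simp only [crossMul, LinearMap.comp_apply, TensorProduct.map_tmul]
  rw [← LinearMap.comp_apply ι p, ← LinearMap.comp_apply ι p, hsplit,
    crossmulAmb_nabla_left hW hφ, crossmulAmb_nabla_right hW hφ hσ]

theorem crossMul_splitAct_left (hW : IsWeakHopf W) (hφ : IsWeakModAlg W φ)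
    (hσ : IsRegPair2 W φ σ σinv) (hsplit : ι ∘ₗ p = nabla W φ) (hretr : p ∘ₗ ι = LinearMap.id)
    (a : A) (x y : P) :
    crossMul W φ σ p ι (splitAct p ι a x ⊗ₜ y) =
      splitAct p ι a (crossMul W φ σ p ι (x ⊗ₜ y)) := by
  obtain ⟨z, rfl⟩ := split_surjective hretr x
  obtain ⟨w, rfl⟩ := split_surjective hretr y
  rw [splitAct_split hsplit hretr, crossMul_split hW hφ hσ hsplit, crossmulAmb_leftMul,
    crossMul_split hW hφ hσ hsplit, splitAct_split hsplit hretr]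

/-- `f(h)(a • y) = Σ (h₁ · a) • (f(h₂) y)` for the total integral `f = p ∘ (η ⊗ H)`. -/
theorem crossMul_integral_splitAct (hW : IsWeakHopf W) (hφ : IsWeakModAlg W φ)
    (hσ : IsRegPair2 W φ σ σinv) (hsplit : ι ∘ₗ p = nabla W φ) (hretr : p ∘ₗ ι = LinearMap.id)
    (h : H) (a : A) (y : P) :
    crossMul W φ σ p ι (p (1 ⊗ₜ h) ⊗ₜ splitAct p ι a y) =
      pairing W.δ (splitAct p ι) (actOn φ a)
        ((TensorProduct.curry (crossMul W φ σ p ι)).flip y ∘ₗ p ∘ₗ TensorProduct.mk k A H 1) h := by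
  obtain ⟨w, rfl⟩ := split_surjective hretr y
  obtain ⟨s, hs⟩ := TensorProduct.exists_finset (W.δ h)
  induction w using TensorProduct.induction_on with
  | zero => simp [pairing_apply_of_eq_sum _ _ _ _ hs]
  | add x y hx hy =>
    simp only [map_add, TensorProduct.tmul_add, hx, hy, pairing_apply_of_eq_sum _ _ _ _ hs,
      LinearMap.comp_apply, LinearMap.add_apply, Finset.sum_add_distrib]
  | tmul b g =>
    have key := LinearMap.congr_fun (pairing_leftMul_assoc hW.coassoc_δ (actOn φ a) (actOn φ b)
      (σHA W σ ∘ₗ (TensorProduct.mk k H H).flip g)) h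
    rw [hφ.pairing_actOn] at key
    rw [splitAct_split hsplit hretr, leftMul_tmul, crossMul_split hW hφ hσ hsplit,
      crossmulAmb_tmul, leftMul_one, key, pairing_apply_of_eq_sum _ _ _ _ hs,
      pairing_apply_of_eq_sum _ _ _ _ hs, map_sum]
    refine Finset.sum_congr rfl fun i _ => ?_
    simp only [LinearMap.comp_apply, LinearMap.flip_apply, TensorProduct.curry_apply,
      TensorProduct.mk_apply]
    rw [crossMul_split hW hφ hσ hsplit, crossmulAmb_tmul, leftMul_one,
      splitAct_split hsplit hretr]

theorem crossMul_crossInc (hW : IsWeakHopf W) (hφ : IsWeakModAlg W φ)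
    (hσ : IsRegPair2 W φ σ σinv) (h3 : CrossedG3 W φ σ)
    (hsplit : ι ∘ₗ p = nabla W φ) (hretr : p ∘ₗ ι = LinearMap.id) (a : A) (y : P) :
    crossMul W φ σ p ι (crossInc p a ⊗ₜ y) = splitAct p ι a y := by
  obtain ⟨w, rfl⟩ := split_surjective hretr y
  induction w using TensorProduct.induction_on with
  | zero => simp
  | add x y hx hy => simp only [map_add, TensorProduct.tmul_add, hx, hy]
  | tmul b g =>
    rw [crossInc, LinearMap.comp_apply, LinearMap.flip_apply, TensorProduct.mk_apply,
      crossMul_split hW hφ hσ hsplit, crossmulAmb_tmul, pairing_actOn_one hW hφ,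
      pairing_u1_σHA hW hφ hσ, LinearMap.comp_apply, LinearMap.flip_apply,
      TensorProduct.mk_apply, σHA_one_tmul hW hσ h3, ← nabla_tmul, ← nabla_leftMul,
      split_nabla hsplit hretr, splitAct_split hsplit hretr]

theorem crossInc_injective (hW : IsWeakHopf W) (hφ : IsWeakModAlg W φ)
    (hsplit : ι ∘ₗ p = nabla W φ) : Function.Injective (crossInc (k := k) (H := H) p) := by
  let r : A ⊗[k] H →ₗ[k] A := (TensorProduct.rid k A).toLinearMap ∘ₗ LinearMap.lTensor A W.ε
  have hr : ∀ a, r (ι (crossInc p a)) = a := by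
    intro a
    have h1 : r (LinearMap.rTensor H (u1 φ) (W.δ 1)) = 1 := by
      have h2 := congrArg (u1 φ) (hW.counit_right 1)
      rw [u1_apply 1, hφ.1] at h2
      rw [← h2]
      obtain ⟨s, hs⟩ := TensorProduct.exists_finset (W.δ 1)
      simp [hs, r]
    have hl : ∀ z, r (leftMul k H A a z) = a * r z := by
      intro z
      obtain ⟨s, rfl⟩ := TensorProduct.exists_finset z
      simp [leftMul_tmul, r, Finset.mul_sum]
    have hi : ι (crossInc p a) = nabla W φ (a ⊗ₜ 1) := LinearMap.congr_fun hsplit _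
    rw [hi, nabla_tmul, hl, h1, mul_one]
  exact fun a b hab => by rw [← hr a, hab, hr b]

/-- `f ∧ f⁻¹ = i ∘ u₁` for the total integral `f = p ∘ (η ⊗ H)`. -/
theorem dGen_crossCoact_crossUnit (hW : IsWeakHopf W) (hcc : Cocomm W) (hφ : IsWeakModAlg W φ)
    (hsplit : ι ∘ₗ p = nabla W φ) (hretr : p ∘ₗ ι = LinearMap.id) :
    dGen W (crossCoact W p ι (crossUnit W φ p)) = crossInc p ∘ₗ u1 φ := by
  have hρ : crossCoact W p ι (crossUnit W φ p) =
      LinearMap.rTensor H (p ∘ₗ TensorProduct.mk k A H 1) (W.δ 1) := by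
    have hp : p ∘ₗ TensorProduct.mk k A H 1 =
        pairing W.δ (splitAct p ι) (u1 φ) (p ∘ₗ TensorProduct.mk k A H 1) := by
      ext x
      obtain ⟨s, hs⟩ := TensorProduct.exists_finset (W.δ x)
      rw [pairing_apply_of_eq_sum _ _ _ _ hs, LinearMap.comp_apply, TensorProduct.mk_apply,
        ← split_nabla hsplit hretr, nabla_tmul, leftMul_one]
      simp [hs, splitAct_split hsplit hretr, leftMul_tmul]
    have hsum : ∀ (a : A) (t : H ⊗[k] H),
        LinearMap.rTensor H p ((TensorProduct.assoc k A H H).symm (a ⊗ₜ t)) =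
          LinearMap.rTensor H (splitAct p ι a)
            (LinearMap.rTensor H (p ∘ₗ TensorProduct.mk k A H 1) t) := by
      intro a t
      obtain ⟨s, rfl⟩ := TensorProduct.exists_finset t
      simp [TensorProduct.tmul_sum, splitAct_split hsplit hretr, leftMul_tmul]
    have hι : ι (crossUnit W φ p) = LinearMap.rTensor H (u1 φ) (W.δ 1) := by
      rw [crossUnit, split_nabla hsplit hretr, ← LinearMap.comp_apply, hsplit, nabla_tmul,
        leftMul_one]
    obtain ⟨s, hs⟩ := TensorProduct.exists_finset (W.δ 1)
    have key := LinearMap.congr_fun (pairing_assoc hW.coassoc_δ (splitAct p ι)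
      (TensorProduct.mk k P H) (TensorProduct.mk k P H)
      (LinearMap.rTensorHom H ∘ₗ splitAct p ι) (fun _ _ _ => rfl) (u1 φ)
      (p ∘ₗ TensorProduct.mk k A H 1) LinearMap.id) 1
    rw [← hp, ← rTensor_comp_δ_eq_pairing, pairing_apply_of_eq_sum _ _ _ _ hs,
      LinearMap.comp_apply] at key
    rw [key]
    simp only [crossCoact, LinearMap.comp_apply, hι, hs, map_sum, LinearMap.rTensor_tmul,
      LinearMap.lTensor_tmul, LinearEquiv.coe_coe, hsum, LinearMap.coe_rTensorHom]
  have hPiL : ∀ h, dGen W (crossCoact W p ι (crossUnit W φ p)) h = p (1 ⊗ₜ PiL W h) := by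
    intro h
    rw [hρ]
    conv_lhs => rw [← hcc 1]
    obtain ⟨s, hs⟩ := TensorProduct.exists_finset (W.δ 1)
    simp [dGen, PiL, hs, TensorProduct.tmul_sum]
  ext h
  have hu : LinearMap.rTensor H (u1 φ) (W.δ (PiL W h)) =
      leftMul k H A (u1 φ h) (LinearMap.rTensor H (u1 φ) (W.δ 1)) := by
    obtain ⟨s, hs⟩ := TensorProduct.exists_finset (W.δ 1)
    rw [δ_PiL hW, hs]
    simp only [Finset.mul_sum, map_sum, Algebra.TensorProduct.tmul_mul_tmul, one_mul,
      LinearMap.rTensor_tmul, leftMul_tmul]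
    refine Finset.sum_congr rfl fun i _ => ?_
    rw [u1_apply, hφ.2.2.1, hφ.2.2.2]
    rfl
  rw [hPiL, ← split_nabla hsplit hretr, nabla_tmul, leftMul_one, hu, ← nabla_tmul,
    split_nabla hsplit hretr]
  rfl

end Splitting

end CrossedProduct


/-- Let `(φ, σ)` be a crossed system for a cocommutative
weak Hopf algebra `H` over `A` and consider the `H`-cleft extension
`A ↪ A×_σH` with the convolution invertible total integral
`f = p∘(η_A⊗H)`.  If `(ϕ, τ)` is the crossed system induced by `f` on the
coinvariant algebra `A` of `A×_σH`, then `(ϕ, τ) = (φ, σ)`. -/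
theorem statement16 {k H A P : Type} [CommRing k] [Ring H] [Algebra k H]
    [Ring A] [Algebra k A] [AddCommGroup P] [Module k P]
    (W : HopfData k H) (hW : IsWeakHopf W) (hcc : Cocomm W)
    (φ : H ⊗[k] A →ₗ[k] A) (σ σinv : H ⊗[k] H →ₗ[k] A)
    (hcs : IsCrossedSystem W φ σ σinv)
    (p : A ⊗[k] H →ₗ[k] P) (ι : P →ₗ[k] A ⊗[k] H)
    (hsplit : ι ∘ₗ p = nabla W φ) (hretr : p ∘ₗ ι = LinearMap.id) :
    ∀ m e ρP f, m = crossMul W φ σ p ι → e = crossUnit W φ p →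
      ρP = crossCoact W p ι → f = p ∘ₗ TensorProduct.mk k A H 1 →
      ∀ finv : H →ₗ[k] P,
        -- `finv` is the convolution inverse of the total integral `f`:
        convG k W.δ m finv f = eGen W (ρP e) →
        convG k W.δ m f finv = dGen W (ρP e) →
        convG k W.δ m (convG k W.δ m finv f) finv = finv →
        ∀ (ϕ : H ⊗[k] A →ₗ[k] A) (τ : H ⊗[k] H →ₗ[k] A),
          -- `(ϕ, τ)` is the crossed system induced by `f` on the coinvariants:
          crossInc p ∘ₗ ϕ = phiAmb W m f finv (crossInc p) →
          crossInc p ∘ₗ τ = sigmaAmb W m f finv →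
          ϕ = φ ∧ τ = σ := by
  rintro m e ρP f rfl rfl rfl rfl finv - hffinv - ϕ τ hϕ hτ
  obtain ⟨hφ, hσ, -, -, h3⟩ := hcs
  rw [dGen_crossCoact_crossUnit hW hcc hφ hsplit hretr, convG_eq_pairing] at hffinv
  have hinj := crossInc_injective hW hφ hsplit
  have hact : ∀ a b, splitAct p ι a (crossInc p b) = crossInc p (a * b) := fun a b => by
    simp only [crossInc, LinearMap.comp_apply, LinearMap.flip_apply, TensorProduct.mk_apply,
      splitAct_split hsplit hretr, leftMul_tmul]
  constructor
  · refine TensorProduct.ext' fun h a => hinj ?_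
    rw [← LinearMap.comp_apply, hϕ]
    have hamb : phiAmb W (crossMul W φ σ p ι) (p ∘ₗ TensorProduct.mk k A H 1) finv (crossInc p)
        (h ⊗ₜ a) = pairing W.δ (TensorProduct.curry (crossMul W φ σ p ι))
          (p ∘ₗ TensorProduct.mk k A H 1) (splitAct p ι a ∘ₗ finv) h := by
      obtain ⟨s, hs⟩ := TensorProduct.exists_finset (W.δ h)
      rw [pairing_apply_of_eq_sum _ _ _ _ hs]
      simp [phiAmb, mulSwizG, hs, TensorProduct.sum_tmul, crossMul_crossInc hW hφ hσ h3 hsplit hretr]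
    have hcomm : pairing W.δ (TensorProduct.curry (crossMul W φ σ p ι))
          (p ∘ₗ TensorProduct.mk k A H 1) (splitAct p ι a ∘ₗ finv) =
        pairing W.δ LinearMap.id (pairing W.δ
          ((LinearMap.llcomp k P P P).compl₁₂ (splitAct p ι)
            (TensorProduct.curry (crossMul W φ σ p ι))) (actOn φ a)
          (p ∘ₗ TensorProduct.mk k A H 1)) finv := by
      ext x
      obtain ⟨s, hs⟩ := TensorProduct.exists_finset (W.δ x)
      rw [pairing_apply_of_eq_sum _ _ _ _ hs, pairing_apply_of_eq_sum _ _ _ _ hs]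
      refine Finset.sum_congr rfl fun i _ => ?_
      have key := crossMul_integral_splitAct hW hφ hσ hsplit hretr i.1 a (finv i.2)
      obtain ⟨t, ht⟩ := TensorProduct.exists_finset (W.δ i.1)
      rw [pairing_apply_of_eq_sum _ _ _ _ ht] at key
      rw [pairing_apply_of_eq_sum _ _ _ _ ht, map_sum, LinearMap.sum_apply]
      exact key
    rw [hamb, hcomm, pairing_assoc hW.coassoc_δ _ _ (TensorProduct.curry (crossMul W φ σ p ι))
      (splitAct p ι) (fun _ _ _ => rfl), hffinv]
    have hend := map_pairing W.δ (LinearMap.mul k A) (splitAct p ι) (crossInc p) (crossInc p)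
      (fun x y => (hact x y).symm) (actOn φ a) (actOn φ 1)
    rw [hφ.pairing_actOn, mul_one] at hend
    exact (LinearMap.congr_fun hend h).symm
  · have hf : crossMul W φ σ p ι ∘ₗ TensorProduct.map (p ∘ₗ TensorProduct.mk k A H 1)
        (p ∘ₗ TensorProduct.mk k A H 1) = pairing (δ2 W) (splitAct p ι) σ
          ((p ∘ₗ TensorProduct.mk k A H 1) ∘ₗ LinearMap.mul' k H) := by
      have hpσ := map_pairing (δ2 W) (TensorProduct.mk k A H) (splitAct p ι) p
        (p ∘ₗ TensorProduct.mk k A H 1) (fun a h => by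
          simp [splitAct_split hsplit hretr, leftMul_tmul]) σ (LinearMap.mul' k H)
      rw [← hpσ, ← σHA_eq_pairing]
      refine TensorProduct.ext' fun g h => ?_
      simp only [LinearMap.comp_apply, TensorProduct.map_tmul, TensorProduct.mk_apply]
      rw [crossMul_split hW hφ hσ hsplit, crossmulAmb_tmul, leftMul_one,
        pairing_u1_σHA hW hφ hσ]
      rfl
    refine LinearMap.ext fun c => hinj ?_
    rw [← LinearMap.comp_apply, hτ, sigmaAmb, convG_eq_pairing, hf,
      pairing_assoc hW.coassoc_δ2 _ _ (TensorProduct.curry (crossMul W φ σ p ι)) (splitAct p ι)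
        (fun a x y => crossMul_splitAct_left hW hφ hσ hsplit hretr a x y),
      pairing_δ2_comp_mul' hW, hffinv]
    have hend := map_pairing (δ2 W) (LinearMap.mul k A) (splitAct p ι) (crossInc p) (crossInc p)
      (fun x y => (hact x y).symm) σ (u2 φ)
    rw [pairing_u2_right hW hσ] at hend
    exact (LinearMap.congr_fun hend c).symm

end WHA

end
end

section
/- Let H be a cocommutative weak Hopf algebra over a commutative ring k and A_H ↪ A an H-cleft extension. If f: H→A and g: H→A are two convolution invertible total integrals, with induced crossed systems (φ_{A_H}, σ_{A_H}) and (ϕ_{A_H}, τ_{A_H}) on A_H respectively, then (φ_{A_H}, σ_{A_H}) and (ϕ_{A_H}, τ_{A_H}) are equivalent crossed systems; an equivalence is realized by the factorization through A_H of h̃ = f∧g^{-1}. -/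
open TensorProduct

noncomputable section

namespace WHA

variable (k : Type) [CommRing k]

variable (H : Type) [Ring H] [Algebra k H]

variable {k H}

section Convolution

variable {C A B : Type} [AddCommGroup C] [Module k C] [Ring A] [Algebra k A] [Ring B] [Algebra k B]

/-- Coassociativity of a comultiplication. -/
def IsCoassoc (δC : C →ₗ[k] C ⊗[k] C) : Prop :=
  ∀ c, (TensorProduct.assoc k C C C) (δC.rTensor C (δC c)) = δC.lTensor C (δC c)

theorem conv_assoc {δC : C →ₗ[k] C ⊗[k] C} (hδ : IsCoassoc δC)
    (p q r : C →ₗ[k] A) :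
    conv k δC (conv k δC p q) r = conv k δC p (conv k δC q r) := by
  ext c
  let M : C ⊗[k] (C ⊗[k] C) →ₗ[k] A :=
    LinearMap.mul' k A ∘ₗ TensorProduct.map p (LinearMap.mul' k A ∘ₗ TensorProduct.map q r)
  have left : ∀ t : C ⊗[k] C, LinearMap.mul' k A (TensorProduct.map (conv k δC p q) r t) =
      M ((TensorProduct.assoc k C C C) (δC.rTensor C t)) := by
    intro t
    induction t with
    | zero => simp
    | add s t hs ht => simp only [map_add, hs, ht]
    | tmul x y =>
      simp only [conv, convG, TensorProduct.map_tmul, LinearMap.rTensor_tmul,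
        LinearMap.comp_apply, LinearMap.mul'_apply]
      induction δC x with
      | zero => simp
      | add s t hs ht => simp only [map_add, add_mul, add_tmul, hs, ht]
      | tmul u v => simp [M, mul_assoc]
  have right : ∀ t : C ⊗[k] C, LinearMap.mul' k A (TensorProduct.map p (conv k δC q r) t) =
      M (δC.lTensor C t) := by
    intro t
    induction t with
    | zero => simp
    | add s t hs ht => simp only [map_add, hs, ht]
    | tmul x y => simp [M, conv, convG]
  exact (left _).trans ((congrArg M (hδ c)).trans (right _).symm)

theorem comp_conv_of_map_mul (δC : C →ₗ[k] C ⊗[k] C) (π : A →ₗ[k] B)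
    (hπ : ∀ x y, π (x * y) = π x * π y) (p q : C →ₗ[k] A) :
    π ∘ₗ conv k δC p q = conv k δC (π ∘ₗ p) (π ∘ₗ q) := by
  ext c
  simp only [conv, convG, LinearMap.comp_apply]
  induction δC c with
  | zero => simp
  | add s t hs ht => simp only [map_add, hs, ht]
  | tmul x y => simp [hπ]

theorem conv_comp {E : Type} [AddCommGroup E] [Module k E] {δC : C →ₗ[k] C ⊗[k] C}
    {δE : E →ₗ[k] E ⊗[k] E} {π : E →ₗ[k] C}
    (hπ : δC ∘ₗ π = TensorProduct.map π π ∘ₗ δE) (p q : C →ₗ[k] A) :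
    conv k δC p q ∘ₗ π = conv k δE (p ∘ₗ π) (q ∘ₗ π) := by
  simp only [conv, convG, LinearMap.comp_assoc, hπ, TensorProduct.map_comp]

theorem mulLeft_comp_conv (δC : C →ₗ[k] C ⊗[k] C) (a : A) (p q : C →ₗ[k] A) :
    LinearMap.mulLeft k a ∘ₗ conv k δC p q = conv k δC (LinearMap.mulLeft k a ∘ₗ p) q := by
  ext c
  simp only [conv, convG, LinearMap.comp_apply]
  induction δC c with
  | zero => simp
  | add s t hs ht => simp only [map_add, hs, ht]
  | tmul x y => simp [mul_assoc]

theorem mulRight_comp_conv (δC : C →ₗ[k] C ⊗[k] C) (a : A) (p q : C →ₗ[k] A) :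
    LinearMap.mulRight k a ∘ₗ conv k δC p q = conv k δC p (LinearMap.mulRight k a ∘ₗ q) := by
  ext c
  simp only [conv, convG, LinearMap.comp_apply]
  induction δC c with
  | zero => simp
  | add s t hs ht => simp only [map_add, hs, ht]
  | tmul x y => simp [mul_assoc]

end Convolution

section Coinvariants

/-- The contraction `x ⊗ y ↦ ε(x) • y`. -/
def counitLeft (W : HopfData k H) : H ⊗[k] H →ₗ[k] H :=
  (TensorProduct.lid k H).toLinearMap ∘ₗ LinearMap.rTensor H W.ε

@[simp]
theorem counitLeft_tmul (W : HopfData k H) (x y : H) :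
    counitLeft W (x ⊗ₜ[k] y) = W.ε x • y := by
  simp [counitLeft]

/-- The map `x ↦ ε(x 1₁) • 1₂`. -/
def PiRbar (W : HopfData k H) : H →ₗ[k] H :=
  counitLeft W ∘ₗ LinearMap.mulRight k (W.δ 1) ∘ₗ (TensorProduct.mk k H H).flip 1

theorem PiRbar_apply (W : HopfData k H) (x : H) :
    PiRbar W x = counitLeft W ((x ⊗ₜ[k] 1) * W.δ 1) := rfl

theorem PiL_apply (W : HopfData k H) (x : H) :
    PiL W x = counitLeft W (W.δ 1 * (x ⊗ₜ[k] 1)) := by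
  simp only [PiL, LinearMap.comp_apply, TensorProduct.mk_apply]
  induction W.δ 1 with
  | zero => simp
  | add s t hs ht => simp only [add_tmul, add_mul, map_add, hs, ht]
  | tmul u v => simp

variable {W : HopfData k H}

theorem counitLeft_comul (hW : IsWeakHopf W) (h : H) : counitLeft W (W.δ h) = h :=
  hW.counit_left h

theorem counitLeft_mul_comul (hW : IsWeakHopf W) (x h : H) :
    counitLeft W ((x ⊗ₜ[k] 1) * W.δ h) = PiRbar W x * h := by
  let Q (r : H ⊗[k] H) : H ⊗[k] (H ⊗[k] H) →ₗ[k] H :=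
    (TensorProduct.lid k H).toLinearMap ∘ₗ TensorProduct.map (W.ε ∘ₗ LinearMap.mulLeft k x)
      (counitLeft W ∘ₗ LinearMap.mulRight k r)
  have expand : ∀ s r : H ⊗[k] H, counitLeft W ((x ⊗ₜ[k] 1) * (s * r)) =
      Q r ((TensorProduct.assoc k H H H) (W.δ.rTensor H s)) := by
    intro s r
    induction s with
    | zero => simp
    | add s t hs ht => simp only [map_add, add_mul, mul_add, hs, ht]
    | tmul u v =>
      induction r with
      | zero => simp [Q]
      | add r t hr ht =>
        have hQ : Q (r + t) = Q r + Q t := by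
          ext; simp [Q, mul_add]
        simp only [map_add, mul_add, hQ, LinearMap.add_apply, hr, ht]
      | tmul p q =>
        simp only [Algebra.TensorProduct.tmul_mul_tmul, counitLeft_tmul, one_mul,
          LinearMap.rTensor_tmul]
        rw [← mul_assoc, hW.a2]
        induction W.δ u with
        | zero => simp
        | add s t hs ht => simp only [map_add, add_smul, add_tmul, hs, ht]
        | tmul a b => simpa [Q, mul_smul] using smul_comm _ _ _
  have collapse : ∀ s : H ⊗[k] H, Q (W.δ h) (W.δ.lTensor H s) =
      counitLeft W ((x ⊗ₜ[k] 1) * s) * h := by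
    intro s
    induction s with
    | zero => simp
    | add s t hs ht => simp only [map_add, add_mul, mul_add, hs, ht]
    | tmul u v => simp [Q, ← hW.a1, counitLeft_comul hW]
  rw [PiRbar_apply, ← collapse, ← hW.coassoc, ← expand, ← hW.a1, one_mul]

theorem counitLeft_comul_mul (hW : IsWeakHopf W) (x h : H) :
    counitLeft W (W.δ h * (x ⊗ₜ[k] 1)) = h * PiL W x := by
  let Q (r : H ⊗[k] H) : H ⊗[k] (H ⊗[k] H) →ₗ[k] H :=
    (TensorProduct.lid k H).toLinearMap ∘ₗ TensorProduct.map (W.ε ∘ₗ LinearMap.mulRight k x)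
      (counitLeft W ∘ₗ LinearMap.mulLeft k r)
  have expand : ∀ s r : H ⊗[k] H, counitLeft W (r * s * (x ⊗ₜ[k] 1)) =
      Q r ((TensorProduct.assoc k H H H) (W.δ.rTensor H s)) := by
    intro s r
    induction s with
    | zero => simp
    | add s t hs ht => simp only [map_add, add_mul, mul_add, hs, ht]
    | tmul u v =>
      induction r with
      | zero => simp [Q]
      | add r t hr ht =>
        have hQ : Q (r + t) = Q r + Q t := by
          ext; simp [Q, add_mul]
        simp only [map_add, add_mul, hQ, LinearMap.add_apply, hr, ht]
      | tmul p q =>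
        simp only [Algebra.TensorProduct.tmul_mul_tmul, counitLeft_tmul, mul_one,
          LinearMap.rTensor_tmul]
        rw [hW.a2']
        induction W.δ u with
        | zero => simp
        | add s t hs ht => simp only [map_add, add_smul, add_tmul, hs, ht]
        | tmul a b => simp [Q, mul_smul]
  have collapse : ∀ s : H ⊗[k] H, Q (W.δ h) (W.δ.lTensor H s) =
      h * counitLeft W (s * (x ⊗ₜ[k] 1)) := by
    intro s
    induction s with
    | zero => simp
    | add s t hs ht => simp only [map_add, add_mul, mul_add, hs, ht]
    | tmul u v => simp [Q, ← hW.a1, counitLeft_comul hW]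
  rw [PiL_apply, ← collapse, ← hW.coassoc, ← expand, ← hW.a1, mul_one]

theorem lTensor_PiRbar_comul_one (hW : IsWeakHopf W) :
    LinearMap.lTensor H (PiRbar W) (W.δ 1) = W.δ 1 := by
  have contract : ∀ s : H ⊗[k] H, LinearMap.lTensor H (counitLeft W)
      ((TensorProduct.map LinearMap.id
        (Algebra.TensorProduct.includeLeft : H →ₐ[k] H ⊗[k] H).toLinearMap) s *
      (Algebra.TensorProduct.includeRight : (H ⊗[k] H) →ₐ[k] H ⊗[k] (H ⊗[k] H)).toLinearMap
        (W.δ 1)) = LinearMap.lTensor H (PiRbar W) s := by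
    intro s
    induction s with
    | zero => simp
    | add s t hs ht => simp only [map_add, add_mul, hs, ht]
    | tmul u v => simp [PiRbar_apply]
  have hcounit : counitLeft W ∘ₗ W.δ = LinearMap.id :=
    LinearMap.ext (counitLeft_comul hW)
  rw [← contract, ← hW.a3, hW.coassoc, ← LinearMap.lTensor_comp_apply, hcounit,
    LinearMap.lTensor_id_apply]

theorem PiRbar_PiL (hW : IsWeakHopf W) (x : H) : PiRbar W (PiL W x) = PiL W x := by
  have slide : ∀ s : H ⊗[k] H, PiRbar W (counitLeft W (s * (x ⊗ₜ[k] 1))) =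
      counitLeft W (LinearMap.lTensor H (PiRbar W) s * (x ⊗ₜ[k] 1)) := by
    intro s
    induction s with
    | zero => simp
    | add s t hs ht => simp only [map_add, add_mul, hs, ht]
    | tmul u v => simp
  rw [PiL_apply, slide, lTensor_PiRbar_comul_one hW]

variable {A : Type} [Ring A] [Algebra k A] {ρ : A →ₗ[k] A ⊗[k] H}

/-- The contraction `(a ⊗ x) ⊗ y ↦ ε(x) • (a ⊗ y)`. -/
def counitMid (W : HopfData k H) (A : Type) [Ring A] [Algebra k A] :
    (A ⊗[k] H) ⊗[k] H →ₗ[k] A ⊗[k] H :=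
  LinearMap.rTensor H ((TensorProduct.rid k A).toLinearMap ∘ₗ LinearMap.lTensor A W.ε)

theorem counitMid_assoc_symm (a : A) (t : H ⊗[k] H) :
    counitMid W A ((TensorProduct.assoc k A H H).symm (a ⊗ₜ[k] t)) =
      a ⊗ₜ[k] counitLeft W t := by
  induction t with
  | zero => simp
  | add s t hs ht => simp only [map_add, tmul_add, hs, ht]
  | tmul x y => simp [counitMid, TensorProduct.smul_tmul]

theorem coaction_eq (hρ : IsComodAlg W ρ) (a : A) :
    LinearMap.rTensor H ρ (ρ a) =
      (TensorProduct.assoc k A H H).symm (LinearMap.lTensor A W.δ (ρ a)) := by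
  rw [← hρ.coassoc, LinearEquiv.symm_apply_apply]

theorem tmul_one_mul_coaction_one (hW : IsWeakHopf W) (hρ : IsComodAlg W ρ) (a : A) :
    (a ⊗ₜ[k] 1) * ρ 1 = LinearMap.lTensor A (PiRbar W) (ρ a) * ρ 1 := by
  have expand : ∀ s : A ⊗[k] H,
      counitMid W A ((ρ a ⊗ₜ[k] 1) * LinearMap.rTensor H ρ s) = (a ⊗ₜ[k] 1) * s := by
    intro s
    induction s with
    | zero => simp
    | add s t hs ht => simp only [map_add, mul_add, hs, ht]
    | tmul b y =>
      have := hρ.counit (a * b)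
      simp [counitMid, ← hρ.mul_compat, this]
  have collapse : ∀ r s : A ⊗[k] H,
      counitMid W A ((r ⊗ₜ[k] 1) *
        (TensorProduct.assoc k A H H).symm (LinearMap.lTensor A W.δ s)) =
      LinearMap.lTensor A (PiRbar W) r * s := by
    intro r s
    induction r with
    | zero => simp
    | add r t hr ht => simp only [map_add, add_mul, add_tmul, hr, ht]
    | tmul b x =>
      induction s with
      | zero => simp
      | add s t hs ht => simp only [map_add, mul_add, hs, ht]
      | tmul c h =>
        have key : ∀ t : H ⊗[k] H, ((b ⊗ₜ[k] x) ⊗ₜ[k] (1 : H)) *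
            (TensorProduct.assoc k A H H).symm (c ⊗ₜ[k] t) =
            (TensorProduct.assoc k A H H).symm ((b * c) ⊗ₜ[k] ((x ⊗ₜ[k] 1) * t)) := by
          intro t
          induction t with
          | zero => simp
          | add s t hs ht => simp only [map_add, mul_add, tmul_add, hs, ht]
          | tmul u v => simp
        rw [LinearMap.lTensor_tmul, key, counitMid_assoc_symm, counitLeft_mul_comul hW]
        simp
  rw [← expand, coaction_eq hρ, collapse]

theorem coaction_one_mul_tmul_one (hW : IsWeakHopf W) (hρ : IsComodAlg W ρ) (a : A) :
    ρ 1 * (a ⊗ₜ[k] 1) = ρ 1 * LinearMap.lTensor A (PiL W) (ρ a) := by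
  have expand : ∀ s : A ⊗[k] H,
      counitMid W A (LinearMap.rTensor H ρ s * (ρ a ⊗ₜ[k] 1)) = s * (a ⊗ₜ[k] 1) := by
    intro s
    induction s with
    | zero => simp
    | add s t hs ht => simp only [map_add, add_mul, hs, ht]
    | tmul b y =>
      have := hρ.counit (b * a)
      simp [counitMid, ← hρ.mul_compat, this]
  have collapse : ∀ r s : A ⊗[k] H,
      counitMid W A ((TensorProduct.assoc k A H H).symm (LinearMap.lTensor A W.δ s) *
        (r ⊗ₜ[k] 1)) =
      s * LinearMap.lTensor A (PiL W) r := by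
    intro r s
    induction r with
    | zero => simp
    | add r t hr ht => simp only [map_add, mul_add, add_tmul, hr, ht]
    | tmul b x =>
      induction s with
      | zero => simp
      | add s t hs ht => simp only [map_add, add_mul, hs, ht]
      | tmul c h =>
        have key : ∀ t : H ⊗[k] H, (TensorProduct.assoc k A H H).symm (c ⊗ₜ[k] t) *
            ((b ⊗ₜ[k] x) ⊗ₜ[k] (1 : H)) =
            (TensorProduct.assoc k A H H).symm ((c * b) ⊗ₜ[k] (t * (x ⊗ₜ[k] 1))) := by
          intro t
          induction t with
          | zero => simp
          | add s t hs ht => simp only [map_add, add_mul, tmul_add, hs, ht]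
          | tmul u v => simp
        rw [LinearMap.lTensor_tmul, key, counitMid_assoc_symm, counitLeft_comul_mul hW]
        simp
  rw [← expand, coaction_eq hρ, collapse]

theorem IsCoinv.coaction_eq_tmul_one_mul (hW : IsWeakHopf W) (hρ : IsComodAlg W ρ) {a : A}
    (ha : IsCoinv ρ a) : ρ a = (a ⊗ₜ[k] 1) * ρ 1 := by
  have slide : ∀ s : A ⊗[k] H, LinearMap.lTensor A (PiL W) (s * (a ⊗ₜ[k] 1)) =
      LinearMap.lTensor A (PiL W) s * (a ⊗ₜ[k] 1) := by
    intro s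
    induction s with
    | zero => simp
    | add s t hs ht => simp only [map_add, add_mul, hs, ht]
    | tmul u v => simp
  have hL : LinearMap.lTensor A (PiL W) (ρ a) = ρ a := by
    rw [ha, zeta, slide, hρ.unit_coinv]
  have hcomp : PiRbar W ∘ₗ PiL W = PiL W := LinearMap.ext (PiRbar_PiL hW)
  have hR : LinearMap.lTensor A (PiRbar W) (ρ a) = ρ a := by
    rw [← hL, ← LinearMap.lTensor_comp_apply, hcomp]
  rw [tmul_one_mul_coaction_one hW hρ, hR, ← hρ.mul_compat, mul_one]

theorem isCoinv_of_coaction_eq_tmul_one_mul (hW : IsWeakHopf W) (hρ : IsComodAlg W ρ) {a : A}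
    (ha : ρ a = (a ⊗ₜ[k] 1) * ρ 1) : IsCoinv ρ a := by
  have slide : ∀ s : A ⊗[k] H, LinearMap.lTensor A (PiL W) ((a ⊗ₜ[k] 1) * s) =
      (a ⊗ₜ[k] 1) * LinearMap.lTensor A (PiL W) s := by
    intro s
    induction s with
    | zero => simp
    | add s t hs ht => simp only [map_add, mul_add, hs, ht]
    | tmul u v => simp
  have hL : LinearMap.lTensor A (PiL W) (ρ a) = ρ a := by
    rw [ha, slide, hρ.unit_coinv]
  rw [IsCoinv, zeta, coaction_one_mul_tmul_one hW hρ, hL, ← hρ.mul_compat, one_mul]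

theorem eGen_tmul {B : Type} [AddCommGroup B] [Module k B] (b : B) (x h : H) :
    eGen W (b ⊗ₜ[k] x) h = W.ε (h * x) • b := by
  simp [eGen]

theorem dGen_tmul {B : Type} [AddCommGroup B] [Module k B] (b : B) (x h : H) :
    dGen W (b ⊗ₜ[k] x) h = W.ε (x * h) • b := by
  simp [dGen]

theorem eGen_add {B : Type} [AddCommGroup B] [Module k B] (s t : B ⊗[k] H) (h : H) :
    eGen W (s + t) h = eGen W s h + eGen W t h := by
  simp [eGen]

/-- Coinvariants commute with the values of `e_A`. -/
theorem IsCoinv.commute_eGen (hW : IsWeakHopf W) (hρ : IsComodAlg W ρ) {a : A}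
    (ha : IsCoinv ρ a) (h : H) : a * eGen W (ρ 1) h = eGen W (ρ 1) h * a := by
  have left : ∀ s : A ⊗[k] H, eGen W ((a ⊗ₜ[k] 1) * s) h = a * eGen W s h := by
    intro s
    induction s with
    | zero => simp [eGen]
    | add s t hs ht => simp only [mul_add, eGen_add, hs, ht]
    | tmul u v => simp [eGen_tmul]
  have right : ∀ s : A ⊗[k] H, eGen W (s * (a ⊗ₜ[k] 1)) h = eGen W s h * a := by
    intro s
    induction s with
    | zero => simp [eGen]
    | add s t hs ht => simp only [add_mul, eGen_add, hs, ht]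
    | tmul u v => simp [eGen_tmul]
  rw [← left, ← right, ← ha.coaction_eq_tmul_one_mul hW hρ]
  exact congrArg (fun s => eGen W s h) ha

end Coinvariants

section Cleaving

variable {W : HopfData k H} {A : Type} [Ring A] [Algebra k A] {ρ : A →ₗ[k] A ⊗[k] H}

theorem IsIntegral.conv_eGen (hρ : IsComodAlg W ρ) {f : H →ₗ[k] A} (hf : IsIntegral W ρ f) :
    conv k W.δ f (eGen W (ρ 1)) = f := by
  ext h
  have key : ∀ (r : H ⊗[k] H) (s : A ⊗[k] H),
      LinearMap.mul' k A (TensorProduct.map f (eGen W s) r) =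
        TensorProduct.rid k A (LinearMap.lTensor A W.ε (LinearMap.rTensor H f r * s)) := by
    intro r s
    induction r with
    | zero => simp
    | add r t hr ht => simp only [map_add, add_mul, hr, ht]
    | tmul x y =>
      induction s with
      | zero => simp [eGen]
      | add s t hs ht =>
        simp only [TensorProduct.map_tmul, LinearMap.mul'_apply] at hs ht
        simp only [TensorProduct.map_tmul, LinearMap.mul'_apply, eGen_add, mul_add, map_add,
          hs, ht]
      | tmul u v => simp [eGen_tmul]
  refine (key _ _).trans ?_
  rw [← hf, ← hρ.mul_compat, mul_one, hρ.counit]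

theorem IsIntegral.coaction_comp {f : H →ₗ[k] A} (hf : IsIntegral W ρ f) :
    ρ ∘ₗ f = conv k W.δ
      ((Algebra.TensorProduct.includeLeft : A →ₐ[k] A ⊗[k] H).toLinearMap ∘ₗ f)
      (Algebra.TensorProduct.includeRight : H →ₐ[k] A ⊗[k] H).toLinearMap := by
  ext h
  simp only [conv, convG, LinearMap.comp_apply, hf h]
  induction W.δ h with
  | zero => simp
  | add s t hs ht => simp only [map_add, hs, ht]
  | tmul x y => simp

variable {f finv g ginv : H →ₗ[k] A}

/-- The convolution `f ∧ g⁻¹` takes values in the coinvariants. -/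
theorem IsCleaving.isCoinv_conv_inv (hW : IsWeakHopf W) (hρ : IsComodAlg W ρ)
    (hf : IsIntegral W ρ f) (hg : IsCleaving W ρ g ginv) (x : H) :
    IsCoinv ρ (conv k W.δ f ginv x) := by
  obtain ⟨hgint, hginv, hgcoinv⟩ := hg
  set h := conv k W.δ f ginv with hh
  let ι := (Algebra.TensorProduct.includeLeft : A →ₐ[k] A ⊗[k] H).toLinearMap
  have hι : ∀ x y, ι (x * y) = ι x * ι y :=
    map_mul (Algebra.TensorProduct.includeLeft : A →ₐ[k] A ⊗[k] H)
  have hcg : conv k W.δ h g = f := by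
    rw [hh, conv_assoc hW.coassoc, hginv.1, hf.conv_eGen hρ]
  have hcd : conv k W.δ h (conv k W.δ g ginv) = h := by
    rw [← conv_assoc hW.coassoc, hcg]
  have hρf : ρ ∘ₗ f = conv k W.δ (ι ∘ₗ h) (ρ ∘ₗ g) := by
    rw [hgint.coaction_comp, ← conv_assoc hW.coassoc, ← comp_conv_of_map_mul _ _ hι, hcg,
      hf.coaction_comp]
  have hρd : ρ ∘ₗ conv k W.δ g ginv = LinearMap.mulRight k (ρ 1) ∘ₗ ι ∘ₗ conv k W.δ g ginv :=
    LinearMap.ext fun y => (hgcoinv y).coaction_eq_tmul_one_mul hW hρ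
  have hρh : ρ ∘ₗ h = LinearMap.mulRight k (ρ 1) ∘ₗ ι ∘ₗ h := by
    conv_lhs => rw [hh, comp_conv_of_map_mul _ _ hρ.mul_compat, hρf, conv_assoc hW.coassoc,
      ← comp_conv_of_map_mul _ _ hρ.mul_compat, hρd, ← mulRight_comp_conv,
      ← comp_conv_of_map_mul _ _ hι, hcd]
  exact isCoinv_of_coaction_eq_tmul_one_mul hW hρ (LinearMap.congr_fun hρh x)

theorem IsCleaving.conv_inv_one (hρ : IsComodAlg W ρ) (hf : IsIntegral W ρ f) (hf1 : f 1 = 1)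
    (hg : IsCleaving W ρ g ginv) (hg1 : g 1 = 1) : conv k W.δ f ginv 1 = 1 := by
  have contract : ∀ p : H →ₗ[k] A, conv k W.δ p ginv 1 =
      LinearMap.mul' k A (LinearMap.lTensor A ginv (LinearMap.rTensor H p (W.δ 1))) := by
    intro p
    simp only [conv, convG, LinearMap.comp_apply]
    rw [← LinearMap.comp_apply (LinearMap.lTensor A ginv), LinearMap.lTensor_comp_rTensor]
  have hunit : ∀ t : A ⊗[k] H,
      dGen W t 1 = TensorProduct.rid k A (LinearMap.lTensor A W.ε t) := by
    intro t
    induction t with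
    | zero => simp [dGen]
    | add s t hs ht => rw [map_add, map_add, ← hs, ← ht]; simp [dGen]
    | tmul u v => simp [dGen_tmul]
  have hδ : LinearMap.rTensor H f (W.δ 1) = LinearMap.rTensor H g (W.δ 1) := by
    rw [← hf 1, ← hg.1 1, hf1, hg1]
  rw [contract, hδ, ← contract, hg.2.1.2.1, hunit, hρ.counit]

end Cleaving

section TensorSquare

variable {W : HopfData k H} {A : Type} [Ring A] [Algebra k A]

/-- The projection `x ⊗ y ↦ ε(y) • x`. -/
def projLeft (W : HopfData k H) : H ⊗[k] H →ₗ[k] H :=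
  (TensorProduct.rid k H).toLinearMap ∘ₗ LinearMap.lTensor H W.ε

/-- The projection `x ⊗ y ↦ ε(x) • y`, as a map of coalgebras. -/
abbrev projRight (W : HopfData k H) : H ⊗[k] H →ₗ[k] H := counitLeft W

@[simp]
theorem projLeft_tmul (W : HopfData k H) (x y : H) :
    projLeft W (x ⊗ₜ[k] y) = W.ε y • x := by
  simp [projLeft]

theorem projLeft_comul (hW : IsWeakHopf W) (h : H) : projLeft W (W.δ h) = h :=
  hW.counit_right h

theorem δ2_coassoc (hW : IsWeakHopf W) : IsCoassoc (δ2 W) := by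
  intro t
  let _ : Coalgebra k H :=
    { comul := W.δ
      counit := W.ε
      coassoc := LinearMap.ext hW.coassoc
      rTensor_counit_comp_comul := by
        ext h
        apply (TensorProduct.lid k H).injective
        simpa using hW.counit_left h
      lTensor_counit_comp_comul := by
        ext h
        apply (TensorProduct.rid k H).injective
        simpa using hW.counit_right h }
  exact Coalgebra.coassoc_apply (R := k) (A := H ⊗[k] H) t

theorem comul_comp_mul' (hW : IsWeakHopf W) :
    W.δ ∘ₗ LinearMap.mul' k H =
      TensorProduct.map (LinearMap.mul' k H) (LinearMap.mul' k H) ∘ₗ δ2 W := by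
  have key : ∀ s t : H ⊗[k] H, s * t =
      TensorProduct.map (LinearMap.mul' k H) (LinearMap.mul' k H)
        (TensorProduct.tensorTensorTensorComm k H H H H (s ⊗ₜ[k] t)) := by
    intro s t
    induction s with
    | zero => simp
    | add s r hs hr => simp only [add_mul, add_tmul, map_add, hs, hr]
    | tmul u v =>
      induction t with
      | zero => simp
      | add t r ht hr => simp only [mul_add, tmul_add, map_add, ht, hr]
      | tmul p q => simp
  ext x y
  simpa [δ2, hW.a1] using key _ _

theorem comul_comp_projLeft (hW : IsWeakHopf W) :
    W.δ ∘ₗ projLeft W = TensorProduct.map (projLeft W) (projLeft W) ∘ₗ δ2 W := by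
  have key : ∀ s t : H ⊗[k] H, TensorProduct.map (projLeft W) (projLeft W)
      (TensorProduct.tensorTensorTensorComm k H H H H (s ⊗ₜ[k] t)) =
        W.ε (projLeft W t) • s := by
    intro s t
    induction s with
    | zero => simp
    | add s r hs hr => simp only [add_tmul, map_add, smul_add, hs, hr]
    | tmul u v =>
      induction t with
      | zero => simp
      | add t r ht hr => simp only [tmul_add, map_add, add_smul, ht, hr]
      | tmul p q => simp [TensorProduct.smul_tmul', mul_smul, smul_comm (W.ε q)]
  ext x y
  simp [δ2, key, projLeft_comul hW]

theorem comul_comp_projRight (hW : IsWeakHopf W) :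
    W.δ ∘ₗ projRight W = TensorProduct.map (projRight W) (projRight W) ∘ₗ δ2 W := by
  have key : ∀ s t : H ⊗[k] H, TensorProduct.map (projRight W) (projRight W)
      (TensorProduct.tensorTensorTensorComm k H H H H (s ⊗ₜ[k] t)) =
        W.ε (projLeft W s) • t := by
    intro s t
    induction s with
    | zero => simp
    | add s r hs hr => simp only [add_tmul, map_add, add_smul, hs, hr]
    | tmul u v =>
      induction t with
      | zero => simp
      | add t r ht hr => simp only [tmul_add, map_add, smul_add, ht, hr]
      | tmul p q => simp [TensorProduct.smul_tmul', mul_smul, smul_comm (W.ε v)]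
  ext x y
  simp [δ2, key, projLeft_comul hW]

theorem conv_projLeft_apply (hW : IsWeakHopf W) (p : H →ₗ[k] A) (q : H ⊗[k] H →ₗ[k] A)
    (x y : H) : conv k (δ2 W) (p ∘ₗ projLeft W) q (x ⊗ₜ[k] y) =
      conv k W.δ p (q ∘ₗ (TensorProduct.mk k H H).flip y) x := by
  have key : ∀ s t : H ⊗[k] H,
      LinearMap.mul' k A (TensorProduct.map (p ∘ₗ projLeft W) q
        (TensorProduct.tensorTensorTensorComm k H H H H (s ⊗ₜ[k] t))) =
      LinearMap.mul' k A (TensorProduct.map p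
        (q ∘ₗ (TensorProduct.mk k H H).flip (counitLeft W t)) s) := by
    intro s t
    induction s with
    | zero => simp
    | add s r hs hr => simp only [add_tmul, map_add, hs, hr]
    | tmul u v =>
      induction t with
      | zero => simp
      | add t r ht hr =>
        simp only [TensorProduct.map_tmul, LinearMap.mul'_apply, LinearMap.comp_apply,
          LinearMap.flip_apply, TensorProduct.mk_apply] at ht hr
        simp only [TensorProduct.map_tmul, LinearMap.mul'_apply, LinearMap.comp_apply,
          LinearMap.add_apply, tmul_add, map_add, ht, hr,
          LinearMap.flip_apply, TensorProduct.mk_apply]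
      | tmul a b => simp
  simpa [conv, convG, δ2, counitLeft_comul hW] using key (W.δ x) (W.δ y)

theorem conv_projRight_projLeft_apply (hW : IsWeakHopf W) (p q : H →ₗ[k] A) (x y : H) :
    conv k (δ2 W) (p ∘ₗ projRight W) (q ∘ₗ projLeft W) (x ⊗ₜ[k] y) = p y * q x := by
  have key : ∀ s t : H ⊗[k] H,
      LinearMap.mul' k A (TensorProduct.map (p ∘ₗ projRight W) (q ∘ₗ projLeft W)
        (TensorProduct.tensorTensorTensorComm k H H H H (s ⊗ₜ[k] t))) =
      p (projLeft W t) * q (counitLeft W s) := by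
    intro s t
    induction s with
    | zero => simp
    | add s r hs hr => simp only [add_tmul, map_add, mul_add, hs, hr]
    | tmul u v =>
      induction t with
      | zero => simp
      | add t r ht hr => simp only [tmul_add, map_add, add_mul, ht, hr]
      | tmul a b => simp [smul_comm (W.ε u)]
  simpa [conv, convG, δ2, counitLeft_comul hW, projLeft_comul hW] using key (W.δ x) (W.δ y)

theorem conv_projLeft_projRight (hW : IsWeakHopf W) (p q : H →ₗ[k] A) :
    conv k (δ2 W) (p ∘ₗ projLeft W) (q ∘ₗ projRight W) =
      LinearMap.mul' k A ∘ₗ TensorProduct.map p q := by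
  ext x y
  have key : ∀ s : H ⊗[k] H, LinearMap.mul' k A (TensorProduct.map p
      ((q ∘ₗ projRight W) ∘ₗ (TensorProduct.mk k H H).flip y) s) = p (projLeft W s) * q y := by
    intro s
    induction s with
    | zero => simp
    | add s r hs hr => simp only [map_add, add_mul, hs, hr]
    | tmul u v => simp
  have := key (W.δ x)
  rw [projLeft_comul hW] at this
  exact (conv_projLeft_apply hW p _ x y).trans this

end TensorSquare

section Induced

variable {W : HopfData k H} {A D : Type} [Ring A] [Algebra k A] [Ring D] [Algebra k D]

theorem phiAmb_tmul (f finv : H →ₗ[k] A) (j : D →ₗ[k] A) (x : H) (b : D) :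
    phiAmb W (LinearMap.mul' k A) f finv j (x ⊗ₜ[k] b) =
      conv k W.δ f (LinearMap.mulLeft k (j b) ∘ₗ finv) x := by
  simp only [phiAmb, conv, convG, LinearMap.comp_apply, TensorProduct.map_tmul]
  induction W.δ x with
  | zero => simp
  | add s t hs ht => simp only [add_tmul, map_add, hs, ht]
  | tmul u v => simp [mulSwizG]

variable {j : D →ₐ[k] A} {f finv : H →ₗ[k] A} {φ : H ⊗[k] D →ₗ[k] D}

theorem comp_action
    (hφ : j.toLinearMap ∘ₗ φ = phiAmb W (LinearMap.mul' k A) f finv j.toLinearMap) (b : D) :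
    j.toLinearMap ∘ₗ φ ∘ₗ (TensorProduct.mk k H D).flip b =
      conv k W.δ f (LinearMap.mulLeft k (j b) ∘ₗ finv) := by
  rw [← LinearMap.comp_assoc, hφ]
  exact LinearMap.ext fun x => phiAmb_tmul f finv j.toLinearMap x b

theorem comp_u1
    (hφ : j.toLinearMap ∘ₗ φ = phiAmb W (LinearMap.mul' k A) f finv j.toLinearMap) :
    j.toLinearMap ∘ₗ u1 φ = conv k W.δ f finv := by
  rw [u1, comp_action hφ, map_one, LinearMap.mulLeft_one, LinearMap.id_comp]

theorem conv_conv_apply (p q r : H →ₗ[k] D) (x : H) :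
    (LinearMap.mul' k D ∘ₗ LinearMap.rTensor D (LinearMap.mul' k D))
      ((TensorProduct.map (TensorProduct.map p q) r) ((LinearMap.rTensor H W.δ) (W.δ x))) =
      conv k W.δ (conv k W.δ p q) r x := by
  conv_rhs => rw [conv, convG]
  simp only [LinearMap.comp_apply]
  induction W.δ x with
  | zero => simp
  | add s t hs ht => simp only [map_add, hs, ht]
  | tmul u v => simp [conv, convG]

theorem comp_twisted_action (hW : IsWeakHopf W)
    (hφ : j.toLinearMap ∘ₗ φ = phiAmb W (LinearMap.mul' k A) f finv j.toLinearMap)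
    (h : H →ₗ[k] D) :
    j.toLinearMap ∘ₗ LinearMap.mul' k D ∘ₗ TensorProduct.map h φ
        ∘ₗ (TensorProduct.assoc k H H D).toLinearMap ∘ₗ TensorProduct.map W.δ h =
      conv k (δ2 W) ((j.toLinearMap ∘ₗ h) ∘ₗ projLeft W) (conv k (δ2 W) (f ∘ₗ projLeft W)
        (conv k (δ2 W) ((j.toLinearMap ∘ₗ h) ∘ₗ projRight W) (finv ∘ₗ projLeft W))) := by
  ext x y
  have inner : conv k (δ2 W) ((j.toLinearMap ∘ₗ h) ∘ₗ projRight W) (finv ∘ₗ projLeft W) ∘ₗ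
      (TensorProduct.mk k H H).flip y = LinearMap.mulLeft k (j (h y)) ∘ₗ finv :=
    LinearMap.ext fun z => conv_projRight_projLeft_apply hW _ _ z y
  have outer : conv k (δ2 W) (f ∘ₗ projLeft W)
      (conv k (δ2 W) ((j.toLinearMap ∘ₗ h) ∘ₗ projRight W) (finv ∘ₗ projLeft W)) ∘ₗ
      (TensorProduct.mk k H H).flip y =
        j.toLinearMap ∘ₗ φ ∘ₗ (TensorProduct.mk k H D).flip (h y) := by
    rw [comp_action hφ, ← inner]
    exact LinearMap.ext fun z => conv_projLeft_apply hW _ _ z y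
  refine Eq.trans ?_ (conv_projLeft_apply hW _ _ x y).symm
  rw [outer]
  simp only [conv, convG, LinearMap.comp_apply, TensorProduct.AlgebraTensorModule.curry_apply,
    TensorProduct.curry_apply, LinearMap.restrictScalars_self, TensorProduct.map_tmul]
  induction W.δ x with
  | zero => simp
  | add s t hs ht => simp only [add_tmul, map_add, hs, ht]
  | tmul u v => simp

theorem sigmaAmb_eq_conv (hW : IsWeakHopf W) (f finv : H →ₗ[k] A) :
    sigmaAmb W (LinearMap.mul' k A) f finv =
      conv k (δ2 W) (conv k (δ2 W) (f ∘ₗ projLeft W) (f ∘ₗ projRight W))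
        (finv ∘ₗ LinearMap.mul' k H) := by
  rw [conv_projLeft_projRight hW]
  rfl

theorem conv_projRight_comm (hW : IsWeakHopf W) {p q : H →ₗ[k] A}
    (hpq : ∀ x y, p y * q x = q x * p y) :
    conv k (δ2 W) (p ∘ₗ projRight W) (q ∘ₗ projLeft W) =
      conv k (δ2 W) (q ∘ₗ projLeft W) (p ∘ₗ projRight W) := by
  rw [conv_projLeft_projRight hW]
  ext x y
  exact (conv_projRight_projLeft_apply hW p q x y).trans (hpq x y)

/-- Gauge transformation of the cocycle of `g` by `f ∧ g⁻¹`, computed in `A`. -/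
theorem sigmaAmb_gauge (hW : IsWeakHopf W) {ρ : A →ₗ[k] A ⊗[k] H} (hρ : IsComodAlg W ρ)
    {f finv g ginv : H →ₗ[k] A} (hf : IsCleaving W ρ f finv) (hg : IsCleaving W ρ g ginv) :
    sigmaAmb W (LinearMap.mul' k A) f finv =
      conv k (δ2 W)
        (conv k (δ2 W) (conv k W.δ f ginv ∘ₗ projLeft W) (conv k (δ2 W) (g ∘ₗ projLeft W)
          (conv k (δ2 W) (conv k W.δ f ginv ∘ₗ projRight W) (ginv ∘ₗ projLeft W))))
        (conv k (δ2 W) (sigmaAmb W (LinearMap.mul' k A) g ginv)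
          (conv k W.δ g finv ∘ₗ LinearMap.mul' k H)) := by
  have hcoinv := IsCleaving.isCoinv_conv_inv hW hρ hf.1 hg
  have hcg : conv k W.δ (conv k W.δ f ginv) g = f := by
    rw [conv_assoc hW.coassoc, hg.2.1.1, hf.1.conv_eGen hρ]
  have hfinv : conv k W.δ (eGen W (ρ 1)) finv = finv := by
    rw [← hf.2.1.1, hf.2.1.2.2]
  have hM : conv k W.δ ginv (conv k W.δ g finv) = finv := by
    rw [← conv_assoc hW.coassoc, hg.2.1.1, hfinv]
  generalize conv k W.δ f ginv = h at hcoinv hcg ⊢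
  have hassoc := fun p q r : H ⊗[k] H →ₗ[k] A => conv_assoc (δ2_coassoc hW) p q r
  have hL := fun p q : H →ₗ[k] A => conv_comp (comul_comp_projLeft hW) p q
  have hR := fun p q : H →ₗ[k] A => conv_comp (comul_comp_projRight hW) p q
  have hcomm : conv k (δ2 W) (h ∘ₗ projRight W) (eGen W (ρ 1) ∘ₗ projLeft W) =
      conv k (δ2 W) (eGen W (ρ 1) ∘ₗ projLeft W) (h ∘ₗ projRight W) :=
    conv_projRight_comm hW fun x y => (hcoinv y).commute_eGen hW hρ x
  simp only [sigmaAmb_eq_conv hW, hassoc]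
  rw [← conv_comp (comul_comp_mul' hW), hM, ← hassoc (ginv ∘ₗ projLeft W), ← hL, hg.2.1.1,
    ← hassoc (h ∘ₗ projRight W), hcomm, hassoc, ← hassoc (h ∘ₗ projRight W), ← hR, hcg,
    ← hassoc (h ∘ₗ projLeft W), ← hL, hcg,
    ← hassoc (f ∘ₗ projLeft W) (eGen W (ρ 1) ∘ₗ projLeft W), ← hL, hf.1.conv_eGen hρ]

theorem IsCoinvPres.exists_factorization {ρ : A →ₗ[k] A ⊗[k] H} (hj : IsCoinvPres ρ j)
    {p : H →ₗ[k] A} (hp : ∀ x, IsCoinv ρ (p x)) :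
    ∃ q : H →ₗ[k] D, j.toLinearMap ∘ₗ q = p := by
  have hrange : ∀ x, p x ∈ LinearMap.range j.toLinearMap := fun x => (hj.2 _).1 (hp x)
  refine ⟨(LinearEquiv.ofInjective j.toLinearMap hj.1).symm.toLinearMap ∘ₗ
    p.codRestrict _ hrange, LinearMap.ext fun x => ?_⟩
  exact congrArg Subtype.val
    ((LinearEquiv.ofInjective j.toLinearMap hj.1).apply_symm_apply ⟨p x, hrange x⟩)

end Induced

/-- Let `A_H ↪ A` be an `H`-cleft extension for a
cocommutative weak Hopf algebra `H`, and let `f` and `g` be two convolution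
invertible total integrals with induced crossed systems `(φf, σf)` and
`(φg, σg)` on `A_H`.  Then the two crossed systems are equivalent, and an
equivalence is realized by the factorization through `A_H` of `f ∧ g⁻¹`
(with inverse the factorization of `g ∧ f⁻¹`). -/
theorem statement17 {k H A D : Type} [CommRing k] [Ring H] [Algebra k H]
    [Ring A] [Algebra k A] [Ring D] [Algebra k D]
    (W : HopfData k H) (hW : IsWeakHopf W) (hcc : Cocomm W)
    (ρ : A →ₗ[k] A ⊗[k] H) (hρ : IsComodAlg W ρ)
    (j : D →ₐ[k] A) (hj : IsCoinvPres ρ j)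
    (f finv : H →ₗ[k] A) (hf : IsCleaving W ρ f finv) (hftot : f 1 = 1)
    (g ginv : H →ₗ[k] A) (hg : IsCleaving W ρ g ginv) (hgtot : g 1 = 1)
    -- the crossed systems induced by `f` and by `g`:
    (φf : H ⊗[k] D →ₗ[k] D)
    (hφf : j.toLinearMap ∘ₗ φf = phiAmb W (LinearMap.mul' k A) f finv j.toLinearMap)
    (σf : H ⊗[k] H →ₗ[k] D)
    (hσf : j.toLinearMap ∘ₗ σf = sigmaAmb W (LinearMap.mul' k A) f finv)
    (φg : H ⊗[k] D →ₗ[k] D)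
    (hφg : j.toLinearMap ∘ₗ φg = phiAmb W (LinearMap.mul' k A) g ginv j.toLinearMap)
    (σg : H ⊗[k] H →ₗ[k] D)
    (hσg : j.toLinearMap ∘ₗ σg = sigmaAmb W (LinearMap.mul' k A) g ginv) :
    u1 φf = u1 φg ∧
    ∃ h' hinv' : H →ₗ[k] D,
      j.toLinearMap ∘ₗ h' = conv k W.δ f ginv ∧
      j.toLinearMap ∘ₗ hinv' = conv k W.δ g finv ∧
      RealizesEquiv W φf φg σf σg h' hinv' := by
  obtain ⟨hfint, ⟨hfe, hfd, hfinv⟩, -⟩ := id hf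
  obtain ⟨hgint, ⟨hge, hgd, hginv⟩, -⟩ := id hg
  rw [hfe] at hfinv
  rw [hge] at hginv
  have hassoc := fun p q r : H →ₗ[k] A => conv_assoc hW.coassoc p q r
  have hmul : ∀ x y, j.toLinearMap (x * y) = j.toLinearMap x * j.toLinearMap y := map_mul j
  have hinj : ∀ p q : H →ₗ[k] D, j.toLinearMap ∘ₗ p = j.toLinearMap ∘ₗ q → p = q :=
    fun p q => (LinearMap.cancel_left hj.1).1
  have hu_f : j.toLinearMap ∘ₗ u1 φf = dGen W (ρ 1) := by
    rw [← hfd]; exact comp_u1 hφf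
  have hu_g : j.toLinearMap ∘ₗ u1 φg = dGen W (ρ 1) := by
    rw [← hgd]; exact comp_u1 hφg
  have hu : u1 φf = u1 φg := hinj _ _ (hu_f.trans hu_g.symm)
  obtain ⟨h', hh'⟩ := hj.exists_factorization
    (IsCleaving.isCoinv_conv_inv hW hρ hfint hg)
  obtain ⟨hinv', hhinv'⟩ := hj.exists_factorization
    (IsCleaving.isCoinv_conv_inv hW hρ hgint hf)
  have hfE := hfint.conv_eGen hρ
  have hgE := hgint.conv_eGen hρ
  have cancel_g : ∀ q : H →ₗ[k] A, conv k W.δ ginv (conv k W.δ g q) =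
      conv k W.δ (eGen W (ρ 1)) q := fun q => by rw [← hassoc, hge]
  have cancel_f : ∀ q : H →ₗ[k] A, conv k W.δ finv (conv k W.δ f q) =
      conv k W.δ (eGen W (ρ 1)) q := fun q => by rw [← hassoc, hfe]
  have hreg : IsRegPair W φf h' hinv' := by
    have right : conv k W.δ h' hinv' = u1 φf := hinj _ _ <| by
      rw [comp_conv_of_map_mul _ _ hmul, hh', hhinv', hu_f, hassoc, cancel_g, hfinv, hfd]
    have left : conv k W.δ hinv' h' = u1 φf := hinj _ _ <| by
      rw [comp_conv_of_map_mul _ _ hmul, hh', hhinv', hu_f, hassoc, cancel_f, hginv, hgd]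
    refine ⟨right, left, ?_, ?_⟩
    · refine hinj _ _ ?_
      rw [right, comp_conv_of_map_mul _ _ hmul, hh', hu_f, ← hfd, hassoc, cancel_f, hginv]
    · refine hinj _ _ ?_
      rw [left, comp_conv_of_map_mul _ _ hmul, hhinv', hu_f, ← hgd, hassoc, cancel_g, hfinv]
  refine ⟨hu, h', hinv', hh', hhinv', hreg, ?_, ?_, ?_, ?_⟩
  · rw [IsRegPair, ← hu]
    exact hreg
  · apply hj.1
    rw [map_one j]
    exact (LinearMap.congr_fun hh' 1).trans (IsCleaving.conv_inv_one hρ hfint hftot hg hgtot)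
  · intro x b
    rw [conv_conv_apply]
    apply hj.1
    have hL : j.toLinearMap ∘ₗ conv k W.δ (conv k W.δ h' (φg ∘ₗ (TensorProduct.mk k H D).flip b))
        hinv' = conv k W.δ f (LinearMap.mulLeft k (j b) ∘ₗ finv) := by
      rw [comp_conv_of_map_mul _ _ hmul, comp_conv_of_map_mul _ _ hmul, hh', hhinv', comp_action hφg,
        hassoc, hassoc, hassoc, cancel_g, ← mulLeft_comp_conv, cancel_g, hfinv, ← hassoc, hfE]
    exact (LinearMap.congr_fun (comp_action hφf b) x).trans (LinearMap.congr_fun hL x).symm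
  · refine (LinearMap.cancel_left (f := j.toLinearMap) hj.1).1 ?_
    rw [hσf, comp_conv_of_map_mul _ _ hmul, comp_conv_of_map_mul _ _ hmul, hσg,
      comp_twisted_action hW hφg, ← LinearMap.comp_assoc, hhinv', hh']
    exact sigmaAmb_gauge hW hρ hf hg

end WHA

end
end
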